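/- arXiv:1408.0611 — 9 statements merged into one kernel-verified Lean document; each statement's English description precedes it below -/
import Mathlib

section
/- Let n ≥ 5 and let k be any field. Then: (i) B_n(k) is generated as a k-algebra by the degree-1 elements a, c_i and c̄_i for 4 ≤ i ≤ n, and c_{ij} for 4 ≤ i < j ≤ n (i.e., c and c̄ lie in the subalgebra generated by these); and (ii) if m denotes the maximal ideal of B_n(k) generated by the images of all the generators a, c, c̄, c_i, c̄_i, c_{ij}, then the k-vector space m/m² has dimension (n−1)(n−2)/2. In particular, the Zariski tangent space of U_n × Spec(k) at the origin has dimension (n−1)(n−2)/2, and the elements a, c_i, c̄_i, c_{ij} form a minimal set of algebra generators of B_n(k). -/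
set_option synthInstance.maxHeartbeats 400000
set_option maxHeartbeats 1000000

noncomputable section

open MvPolynomial

/-- Generators of the ring `B_n(R)`: `a`, `c`, `c̄`, `c_i`, `c̄_i` (`4 ≤ i ≤ n`)
and `c_{ij}` (`4 ≤ i < j ≤ n`). -/
inductive BVar (n : ℕ) : Type where
  | A : BVar n
  | Cc : BVar n
  | Cb : BVar n
  | lo : {i : ℕ // 4 ≤ i ∧ i ≤ n} → BVar n
  | hi : {i : ℕ // 4 ≤ i ∧ i ≤ n} → BVar n
  | mix : {p : ℕ × ℕ // 4 ≤ p.1 ∧ p.1 < p.2 ∧ p.2 ≤ n} → BVar n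

/-- The generator `a` as a polynomial. -/
def pA (n : ℕ) (R : Type*) [CommRing R] : MvPolynomial (BVar n) R := X BVar.A

/-- The generator `c` as a polynomial. -/
def pC (n : ℕ) (R : Type*) [CommRing R] : MvPolynomial (BVar n) R := X BVar.Cc

/-- The generator `c̄` as a polynomial. -/
def pCb (n : ℕ) (R : Type*) [CommRing R] : MvPolynomial (BVar n) R := X BVar.Cb

/-- The generator `c_i` as a polynomial (junk value `0` if `i` is out of range). -/
def pLo (n : ℕ) (R : Type*) [CommRing R] (i : ℕ) : MvPolynomial (BVar n) R :=
  if h : 4 ≤ i ∧ i ≤ n then X (BVar.lo ⟨i, h⟩) else 0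

/-- The generator `c̄_i` as a polynomial (junk value `0` if `i` is out of range). -/
def pHi (n : ℕ) (R : Type*) [CommRing R] (i : ℕ) : MvPolynomial (BVar n) R :=
  if h : 4 ≤ i ∧ i ≤ n then X (BVar.hi ⟨i, h⟩) else 0

/-- The generator `c_{ij}` (for `4 ≤ i < j ≤ n`) as a polynomial
(junk value `0` if out of range). -/
def pMix (n : ℕ) (R : Type*) [CommRing R] (i j : ℕ) : MvPolynomial (BVar n) R :=
  if h : 4 ≤ i ∧ i < j ∧ j ≤ n then X (BVar.mix ⟨(i, j), h⟩) else 0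

/-- The abbreviation `c_{ji} := a + c_i + c̄_i + c_j + c̄_j − c_{ij}` for `i < j`. -/
def pMixRev (n : ℕ) (R : Type*) [CommRing R] (i j : ℕ) : MvPolynomial (BVar n) R :=
  pA n R + pLo n R i + pHi n R i + pLo n R j + pHi n R j - pMix n R i j

/-- The defining relations (R1), (R2), (R3) of `B_n(R)`. -/
def bRels (n : ℕ) (R : Type*) [CommRing R] : Set (MvPolynomial (BVar n) R) :=
  {p | ∃ i j : ℕ, 4 ≤ i ∧ i < j ∧ j ≤ n ∧
      p = (pLo n R j - pLo n R i) * pMix n R i j -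
          ((pA n R + pHi n R i + pLo n R j + pHi n R j) * pLo n R j - pC n R)} ∪
  {p | ∃ i j : ℕ, 4 ≤ i ∧ i < j ∧ j ≤ n ∧
      p = (pHi n R i - pHi n R j) * pMix n R i j -
          ((pA n R + pLo n R i + pHi n R i + pLo n R j) * pHi n R i - pCb n R)} ∪
  {p | ∃ i j k : ℕ, 4 ≤ i ∧ i < j ∧ j < k ∧ k ≤ n ∧
      p = pMix n R i j * pMix n R j k + pMixRev n R i j * pMix n R i k -
          pMix n R i k * pMix n R j k +
          (pA n R + pLo n R k + pHi n R k) * pLo n R k - pC n R}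

/-- The ideal of relations of `B_n(R)`. -/
def bIdeal (n : ℕ) (R : Type*) [CommRing R] : Ideal (MvPolynomial (BVar n) R) :=
  Ideal.span (bRels n R)

/-- The ring `B_n(R)`. -/
abbrev BRing (n : ℕ) (R : Type*) [CommRing R] := MvPolynomial (BVar n) R ⧸ bIdeal n R

/-- The quotient projection onto `B_n(R)`. -/
def bmk (n : ℕ) (R : Type*) [CommRing R] : MvPolynomial (BVar n) R →+* BRing n R :=
  Ideal.Quotient.mk (bIdeal n R)

/-- The set of images in `B_n(k)` of the degree-1 generators `a`, `c_i`, `c̄_i`, `c_{ij}`. -/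
def bGens1 (n : ℕ) (k : Type*) [Field k] : Set (BRing n k) :=
  {x | x = bmk n k (pA n k) ∨
    (∃ i : ℕ, 4 ≤ i ∧ i ≤ n ∧ (x = bmk n k (pLo n k i) ∨ x = bmk n k (pHi n k i))) ∨
    (∃ i j : ℕ, 4 ≤ i ∧ i < j ∧ j ≤ n ∧ x = bmk n k (pMix n k i j))}

/-- The set of images in `B_n(k)` of all the generators `a`, `c`, `c̄`, `c_i`, `c̄_i`, `c_{ij}`. -/
def bGensAll (n : ℕ) (k : Type*) [Field k] : Set (BRing n k) :=
  bGens1 n k ∪ {bmk n k (pC n k), bmk n k (pCb n k)}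

/-- The maximal ideal `m` of `B_n(k)` generated by the images of all the generators. -/
def bMax (n : ℕ) (k : Type*) [Field k] : Ideal (BRing n k) := Ideal.span (bGensAll n k)

/-- `m` as a `k`-submodule. -/
def bM1 (n : ℕ) (k : Type*) [Field k] : Submodule k (BRing n k) :=
  Submodule.restrictScalars k (bMax n k)

/-- `m²` as a `k`-submodule. -/
def bM2 (n : ℕ) (k : Type*) [Field k] : Submodule k (BRing n k) :=
  Submodule.restrictScalars k (bMax n k * bMax n k)

/-- The `k`-vector space `m/m²`. -/
abbrev bCot (n : ℕ) (k : Type*) [Field k] :=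
  bM1 n k ⧸ Submodule.comap (bM1 n k).subtype (bM2 n k)

/-- Index type of the degree-1 generators `a`, `c_i`, `c̄_i`, `c_{ij}`. -/
abbrev DegOneVar (n : ℕ) : Type :=
  Unit ⊕ {i : ℕ // 4 ≤ i ∧ i ≤ n} ⊕ {i : ℕ // 4 ≤ i ∧ i ≤ n} ⊕
    {p : ℕ × ℕ // 4 ≤ p.1 ∧ p.1 < p.2 ∧ p.2 ≤ n}

/-- The inclusion of the degree-1 generators into all generators. -/
def DegOneVar.toBVar {n : ℕ} : DegOneVar n → BVar n
  | .inl _ => BVar.A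
  | .inr (.inl i) => BVar.lo i
  | .inr (.inr (.inl i)) => BVar.hi i
  | .inr (.inr (.inr p)) => BVar.mix p

/-- The shift of `[4, n]` to `Fin (n - 3)`. -/
def indexEquivFin (n : ℕ) : {i : ℕ // 4 ≤ i ∧ i ≤ n} ≃ Fin (n - 3) where
  toFun i := ⟨i.1 - 4, by have := i.2; omega⟩
  invFun j := ⟨j.1 + 4, by have := j.2; omega⟩
  left_inv i := by ext; have := i.2; simp only; omega
  right_inv j := by ext; simp

/-- Pairs `4 ≤ i < j ≤ n`, fibred over the larger index. -/
def pairEquivSigma (n : ℕ) : {p : ℕ × ℕ // 4 ≤ p.1 ∧ p.1 < p.2 ∧ p.2 ≤ n} ≃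
    Σ j : Fin (n - 3), Fin j where
  toFun p := ⟨⟨p.1.2 - 4, by have := p.2; omega⟩, ⟨p.1.1 - 4, by have := p.2; simp only; omega⟩⟩
  invFun q := ⟨(q.2.1 + 4, q.1.1 + 4), by have := q.1.2; have := q.2.2; simp only; omega⟩
  left_inv p := by
    have := p.2
    ext <;> simp only <;> omega
  right_inv q := by
    rcases q with ⟨⟨j, hj⟩, ⟨i, hi⟩⟩
    simp

instance (n : ℕ) : Fintype {i : ℕ // 4 ≤ i ∧ i ≤ n} := Fintype.ofEquiv _ (indexEquivFin n).symm

instance (n : ℕ) : Fintype {p : ℕ × ℕ // 4 ≤ p.1 ∧ p.1 < p.2 ∧ p.2 ≤ n} :=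
  Fintype.ofEquiv _ (pairEquivSigma n).symm

theorem card_degOneVar (n : ℕ) (hn : 3 ≤ n) :
    Fintype.card (DegOneVar n) = (n - 1) * (n - 2) / 2 := by
  obtain ⟨m, rfl⟩ := Nat.exists_eq_add_of_le hn
  simp only [Fintype.card_sum, Fintype.card_unit, Fintype.card_congr (indexEquivFin (3 + m)),
    Fintype.card_congr (pairEquivSigma (3 + m)), Fintype.card_sigma, Fintype.card_fin]
  rw [Fin.sum_univ_eq_sum_range (fun i => i), add_tsub_cancel_left]
  have h := Finset.sum_range_id_mul_two m
  have e : (3 + m - 1) * (3 + m - 2) = m * (m - 1) + 4 * m + 2 := by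
    rw [show 3 + m - 1 = m + 2 by omega, show 3 + m - 2 = m + 1 by omega]
    rcases m with _ | m
    · rfl
    · simp only [add_tsub_cancel_right]; ring
  omega

section

variable (n : ℕ) (k : Type*) [Field k]

/-- The image in `B_n(k)` of a degree-1 generator. -/
def degOneGen (v : DegOneVar n) : BRing n k := bmk n k (X v.toBVar)

variable {n k}

theorem degOneGen_mem_bGens1 (v : DegOneVar n) : degOneGen n k v ∈ bGens1 n k := by
  rcases v with _ | i | i | p
  · exact Or.inl rfl
  · refine Or.inr (Or.inl ⟨i.1, i.2.1, i.2.2, Or.inl ?_⟩)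
    simp only [pLo, dif_pos i.2, Subtype.coe_eta]; rfl
  · refine Or.inr (Or.inl ⟨i.1, i.2.1, i.2.2, Or.inr ?_⟩)
    simp only [pHi, dif_pos i.2, Subtype.coe_eta]; rfl
  · refine Or.inr (Or.inr ⟨p.1.1, p.1.2, p.2.1, p.2.2.1, p.2.2.2, ?_⟩)
    simp only [pMix, dif_pos p.2, Prod.mk.eta, Subtype.coe_eta]; rfl

theorem bGens1_eq_range : bGens1 n k = Set.range (degOneGen n k) := by
  apply Set.Subset.antisymm
  · rintro x (rfl | ⟨i, h1, h2, rfl | rfl⟩ | ⟨i, j, h1, h2, h3, rfl⟩)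
    · exact ⟨.inl (), rfl⟩
    · exact ⟨.inr (.inl ⟨i, h1, h2⟩), by simp only [pLo, dif_pos (And.intro h1 h2)]; rfl⟩
    · exact ⟨.inr (.inr (.inl ⟨i, h1, h2⟩)), by simp only [pHi, dif_pos (And.intro h1 h2)]; rfl⟩
    · exact ⟨.inr (.inr (.inr ⟨(i, j), h1, h2, h3⟩)), by
        simp only [pMix, dif_pos (And.intro h1 (And.intro h2 h3))]; rfl⟩
  · rintro _ ⟨v, rfl⟩
    exact degOneGen_mem_bGens1 v

theorem bmk_eq_zero {p : MvPolynomial (BVar n) k} (h : p ∈ bRels n k) : bmk n k p = 0 :=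
  Ideal.Quotient.eq_zero_iff_mem.2 (Ideal.subset_span h)

theorem bmk_pC (hn : 5 ≤ n) : bmk n k (pC n k) =
    (bmk n k (pA n k) + bmk n k (pHi n k 4) + bmk n k (pLo n k 5) + bmk n k (pHi n k 5)) *
      bmk n k (pLo n k 5) -
        (bmk n k (pLo n k 5) - bmk n k (pLo n k 4)) * bmk n k (pMix n k 4 5) := by
  have h := bmk_eq_zero (n := n) (k := k)
    (Or.inl (Or.inl ⟨4, 5, le_rfl, by norm_num, hn, rfl⟩))
  simp only [map_sub, map_mul, map_add] at h
  linear_combination h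

theorem bmk_pCb (hn : 5 ≤ n) : bmk n k (pCb n k) =
    (bmk n k (pA n k) + bmk n k (pLo n k 4) + bmk n k (pHi n k 4) + bmk n k (pLo n k 5)) *
      bmk n k (pHi n k 4) -
        (bmk n k (pHi n k 4) - bmk n k (pHi n k 5)) * bmk n k (pMix n k 4 5) := by
  have h := bmk_eq_zero (n := n) (k := k)
    (Or.inl (Or.inr ⟨4, 5, le_rfl, by norm_num, hn, rfl⟩))
  simp only [map_sub, map_mul, map_add] at h
  linear_combination h

theorem bmk_pA_mem : bmk n k (pA n k) ∈ bGens1 n k := Or.inl rfl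

theorem bmk_pLo_mem {i : ℕ} (h : 4 ≤ i) (h' : i ≤ n) : bmk n k (pLo n k i) ∈ bGens1 n k :=
  Or.inr (Or.inl ⟨i, h, h', Or.inl rfl⟩)

theorem bmk_pHi_mem {i : ℕ} (h : 4 ≤ i) (h' : i ≤ n) : bmk n k (pHi n k i) ∈ bGens1 n k :=
  Or.inr (Or.inl ⟨i, h, h', Or.inr rfl⟩)

theorem bmk_pMix_mem {i j : ℕ} (h : 4 ≤ i) (h' : i < j) (h'' : j ≤ n) :
    bmk n k (pMix n k i j) ∈ bGens1 n k :=
  Or.inr (Or.inr ⟨i, j, h, h', h'', rfl⟩)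

theorem bmk_X_mem (v : BVar n) : bmk n k (X v) ∈ bGensAll n k := by
  cases v with
  | A => exact Or.inl (degOneGen_mem_bGens1 (.inl ()))
  | Cc => exact Or.inr (Or.inl rfl)
  | Cb => exact Or.inr (Or.inr rfl)
  | lo i => exact Or.inl (degOneGen_mem_bGens1 (.inr (.inl i)))
  | hi i => exact Or.inl (degOneGen_mem_bGens1 (.inr (.inr (.inl i))))
  | mix p => exact Or.inl (degOneGen_mem_bGens1 (.inr (.inr (.inr p))))

/-- If an ideal contains the degree-1 generators, its square contains `c` and `c̄`. -/
theorem bmk_pC_mem_and_bmk_pCb_mem (hn : 5 ≤ n) (I : Ideal (BRing n k))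
    (hI : bGens1 n k ⊆ I) :
    bmk n k (pC n k) ∈ I * I ∧ bmk n k (pCb n k) ∈ I * I := by
  have hA := hI (bmk_pA_mem (n := n) (k := k))
  have hL4 := hI (bmk_pLo_mem (n := n) (k := k) le_rfl (by omega : 4 ≤ n))
  have hL5 := hI (bmk_pLo_mem (n := n) (k := k) (by norm_num) hn)
  have hH4 := hI (bmk_pHi_mem (n := n) (k := k) le_rfl (by omega : 4 ≤ n))
  have hH5 := hI (bmk_pHi_mem (n := n) (k := k) (by norm_num) hn)
  have hM := hI (bmk_pMix_mem (n := n) (k := k) le_rfl (by norm_num) hn)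
  rw [bmk_pC hn, bmk_pCb hn]
  exact ⟨sub_mem (Ideal.mul_mem_mul (add_mem (add_mem (add_mem hA hH4) hL5) hH5) hL5)
      (Ideal.mul_mem_mul (sub_mem hL5 hL4) hM),
    sub_mem (Ideal.mul_mem_mul (add_mem (add_mem (add_mem hA hL4) hH4) hL5) hH4)
      (Ideal.mul_mem_mul (sub_mem hH4 hH5) hM)⟩

theorem bGensAll_subset_adjoin (hn : 5 ≤ n) :
    bGensAll n k ⊆ (Algebra.adjoin k (bGens1 n k) : Set (BRing n k)) := by
  have hS : bGens1 n k ⊆ (Algebra.adjoin k (bGens1 n k) : Set (BRing n k)) :=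
    Algebra.subset_adjoin
  have hA := hS (bmk_pA_mem (n := n) (k := k))
  have hL4 := hS (bmk_pLo_mem (n := n) (k := k) le_rfl (by omega : 4 ≤ n))
  have hL5 := hS (bmk_pLo_mem (n := n) (k := k) (by norm_num) hn)
  have hH4 := hS (bmk_pHi_mem (n := n) (k := k) le_rfl (by omega : 4 ≤ n))
  have hH5 := hS (bmk_pHi_mem (n := n) (k := k) (by norm_num) hn)
  have hM := hS (bmk_pMix_mem (n := n) (k := k) le_rfl (by norm_num) hn)
  rintro x (hx | rfl | rfl)
  · exact hS hx
  · rw [bmk_pC hn]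
    exact sub_mem (mul_mem (add_mem (add_mem (add_mem hA hH4) hL5) hH5) hL5)
      (mul_mem (sub_mem hL5 hL4) hM)
  · rw [bmk_pCb hn]
    exact sub_mem (mul_mem (add_mem (add_mem (add_mem hA hL4) hH4) hL5) hH4)
      (mul_mem (sub_mem hH4 hH5) hM)

theorem adjoin_bGens1 (hn : 5 ≤ n) : Algebra.adjoin k (bGens1 n k) = ⊤ := by
  refine eq_top_iff.2 fun x _ => ?_
  obtain ⟨p, rfl⟩ := Ideal.Quotient.mk_surjective x
  change bmk n k p ∈ _
  induction p using MvPolynomial.induction_on with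
  | C r => exact Subalgebra.algebraMap_mem (Algebra.adjoin k (bGens1 n k)) r
  | add p q hp hq => rw [map_add]; exact add_mem (hp trivial) (hq trivial)
  | mul_X p v hp =>
    rw [map_mul]
    exact mul_mem (hp trivial) (bGensAll_subset_adjoin hn (bmk_X_mem v))

theorem exists_sub_algebraMap_mem_bMax (x : BRing n k) :
    ∃ r : k, x - algebraMap k (BRing n k) r ∈ bMax n k := by
  obtain ⟨p, rfl⟩ := Ideal.Quotient.mk_surjective x
  change ∃ r : k, bmk n k p - algebraMap k (BRing n k) r ∈ bMax n k
  induction p using MvPolynomial.induction_on with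
  | C r =>
    refine ⟨r, ?_⟩
    change algebraMap k (BRing n k) r - algebraMap k (BRing n k) r ∈ bMax n k
    rw [sub_self]
    exact zero_mem _
  | add p q hp hq =>
    obtain ⟨r, hr⟩ := hp
    obtain ⟨s, hs⟩ := hq
    refine ⟨r + s, ?_⟩
    rw [map_add, map_add, add_sub_add_comm]
    exact add_mem hr hs
  | mul_X p v _ =>
    refine ⟨0, ?_⟩
    rw [map_mul, map_zero, sub_zero]
    exact Ideal.mul_mem_left _ _ (Ideal.subset_span (bmk_X_mem v))

theorem bM1_le (hn : 5 ≤ n) :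
    bM1 n k ≤ Submodule.span k (Set.range (degOneGen n k)) ⊔ bM2 n k := by
  intro x hx
  change x ∈ Submodule.span (BRing n k) (bGensAll n k) at hx
  induction hx using Submodule.span_induction with
  | mem x hx =>
    have h := bmk_pC_mem_and_bmk_pCb_mem hn (bMax n k)
      (Set.subset_union_left.trans Ideal.subset_span)
    rcases hx with hx | rfl | rfl
    · rw [bGens1_eq_range] at hx
      exact Submodule.mem_sup_left (Submodule.subset_span hx)
    · exact Submodule.mem_sup_right h.1
    · exact Submodule.mem_sup_right h.2
  | zero => exact zero_mem _
  | add x y _ _ hx hy => exact add_mem hx hy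
  | smul r x hx hx' =>
    obtain ⟨s, hs⟩ := exists_sub_algebraMap_mem_bMax r
    have e : r • x = s • x + (r - algebraMap k (BRing n k) s) * x := by
      rw [smul_eq_mul, Algebra.smul_def s x]; ring
    rw [e]
    exact add_mem (Submodule.smul_mem _ s hx')
      (Submodule.mem_sup_right (Ideal.mul_mem_mul hs hx))

/-- The linear coordinates of a generator, valued in the square-zero extension. -/
def linCoord : BVar n → (DegOneVar n → k)
  | .A => Pi.single (.inl ()) 1
  | .Cc => 0
  | .Cb => 0
  | .lo i => Pi.single (.inr (.inl i)) 1
  | .hi i => Pi.single (.inr (.inr (.inl i))) 1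
  | .mix p => Pi.single (.inr (.inr (.inr p))) 1

variable (n k) in
/-- The map from polynomials to the square-zero extension of `k` reading off the coefficients of
the degree-1 generators. -/
def polyToTsz : MvPolynomial (BVar n) k →ₐ[k] TrivSqZeroExt k (DegOneVar n → k) :=
  aeval fun v => TrivSqZeroExt.inr (linCoord v)

theorem fst_polyToTsz_pA : (polyToTsz n k (pA n k)).fst = 0 := by simp [polyToTsz, pA]

theorem polyToTsz_pC : polyToTsz n k (pC n k) = 0 := by simp [polyToTsz, pC, linCoord]

theorem polyToTsz_pCb : polyToTsz n k (pCb n k) = 0 := by simp [polyToTsz, pCb, linCoord]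

theorem fst_polyToTsz_pLo (i : ℕ) : (polyToTsz n k (pLo n k i)).fst = 0 := by
  unfold pLo; split <;> simp [polyToTsz]

theorem fst_polyToTsz_pHi (i : ℕ) : (polyToTsz n k (pHi n k i)).fst = 0 := by
  unfold pHi; split <;> simp [polyToTsz]

theorem fst_polyToTsz_pMix (i j : ℕ) : (polyToTsz n k (pMix n k i j)).fst = 0 := by
  unfold pMix; split <;> simp [polyToTsz]

theorem polyToTsz_eq_zero {p : MvPolynomial (BVar n) k} (hp : p ∈ bIdeal n k) :
    polyToTsz n k p = 0 := by
  suffices h : bIdeal n k ≤ RingHom.ker (polyToTsz n k) from h hp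
  refine Ideal.span_le.2 ?_
  rintro p ((⟨i, j, -, -, -, rfl⟩ | ⟨i, j, -, -, -, rfl⟩) | ⟨i, j, l, -, -, -, -, rfl⟩) <;>
  · rw [SetLike.mem_coe, RingHom.mem_ker]
    ext <;> simp [pMixRev, fst_polyToTsz_pA, polyToTsz_pC, polyToTsz_pCb, fst_polyToTsz_pLo,
      fst_polyToTsz_pHi, fst_polyToTsz_pMix]

variable (n k) in
/-- The induced map from `B_n(k)` to the square-zero extension. -/
def bToTsz : BRing n k →ₐ[k] TrivSqZeroExt k (DegOneVar n → k) :=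
  Ideal.Quotient.liftₐ (bIdeal n k) (polyToTsz n k) fun _ h => polyToTsz_eq_zero h

theorem bToTsz_bmk (p : MvPolynomial (BVar n) k) : bToTsz n k (bmk n k p) = polyToTsz n k p := rfl

theorem snd_bToTsz_degOneGen (v : DegOneVar n) :
    (bToTsz n k (degOneGen n k v)).snd = Pi.single v 1 := by
  rw [degOneGen, bToTsz_bmk]
  rcases v with _ | i | i | p <;> simp [polyToTsz, DegOneVar.toBVar, linCoord]

theorem fst_bToTsz {x : BRing n k} (hx : x ∈ bMax n k) : (bToTsz n k x).fst = 0 := by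
  suffices h : bMax n k ≤ RingHom.ker ((TrivSqZeroExt.fstHom k k _).comp (bToTsz n k)) from h hx
  refine Ideal.span_le.2 ?_
  rintro _ (hx | rfl | rfl)
  · rw [bGens1_eq_range] at hx
    obtain ⟨v, rfl⟩ := hx
    simp [degOneGen, bToTsz_bmk, polyToTsz]
  · simp [bToTsz_bmk, polyToTsz_pC]
  · simp [bToTsz_bmk, polyToTsz_pCb]

theorem bToTsz_eq_zero {x : BRing n k} (hx : x ∈ bMax n k * bMax n k) : bToTsz n k x = 0 := by
  suffices h : bMax n k * bMax n k ≤ RingHom.ker (bToTsz n k) from h hx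
  refine Ideal.mul_le.2 fun x hx y hy => ?_
  rw [RingHom.mem_ker]
  ext <;> simp [fst_bToTsz hx, fst_bToTsz hy]

variable (n k) in
/-- The coordinates on `m/m²`. -/
def cotCoord : bCot n k →ₗ[k] (DegOneVar n → k) :=
  Submodule.liftQ _ ((TrivSqZeroExt.sndHom k (DegOneVar n → k)).comp
    ((bToTsz n k).toLinearMap.comp (bM1 n k).subtype)) fun x hx => by
      have h : bToTsz n k x.1 = 0 := bToTsz_eq_zero hx
      simp [h]

theorem degOneGen_mem_bM1 (v : DegOneVar n) : degOneGen n k v ∈ bM1 n k :=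
  Ideal.subset_span (Or.inl (degOneGen_mem_bGens1 v))

variable (n k) in
/-- The class in `m/m²` of a degree-1 generator. -/
def cotGen (v : DegOneVar n) : bCot n k := Submodule.Quotient.mk ⟨_, degOneGen_mem_bM1 v⟩

theorem cotCoord_cotGen (v : DegOneVar n) : cotCoord n k (cotGen n k v) = Pi.single v 1 :=
  snd_bToTsz_degOneGen v

theorem linearIndependent_cotGen : LinearIndependent k (cotGen n k) := by
  refine LinearIndependent.of_comp (cotCoord n k) ?_
  convert (Pi.basisFun k (DegOneVar n)).linearIndependent using 1
  ext1 v
  simp [cotCoord_cotGen]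

theorem span_cotGen (hn : 5 ≤ n) : ⊤ ≤ Submodule.span k (Set.range (cotGen n k)) := by
  rintro x -
  obtain ⟨⟨x, hx⟩, rfl⟩ := Submodule.Quotient.mk_surjective _ x
  obtain ⟨y, hy, z, hz, rfl⟩ := Submodule.mem_sup.1 (bM1_le hn hx)
  have hle : Submodule.span k (Set.range (degOneGen n k)) ≤ bM1 n k :=
    Submodule.span_le.2 (Set.range_subset_iff.2 degOneGen_mem_bM1)
  have e : (Submodule.Quotient.mk ⟨y + z, hx⟩ : bCot n k) =
      Submodule.Quotient.mk ⟨y, hle hy⟩ := by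
    rw [Submodule.Quotient.eq]
    change y + z - y ∈ bM2 n k
    rwa [add_sub_cancel_left]
  rw [e]
  clear e hx
  induction hy using Submodule.span_induction with
  | mem y hy =>
    obtain ⟨v, rfl⟩ := hy
    exact Submodule.subset_span ⟨v, rfl⟩
  | zero => exact zero_mem _
  | add x y hx hy hx' hy' => exact add_mem hx' hy'
  | smul r x hx hx' => exact Submodule.smul_mem _ r hx'

end

/-- Corollary 1.6: for `n ≥ 5` and any field `k`, `B_n(k)` is generated as a
`k`-algebra by the degree-1 elements `a, c_i, c̄_i, c_{ij}`, and `dim_k m/m² = (n−1)(n−2)/2`;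
in particular these elements form a minimal set of algebra generators. -/
theorem stmt3 (n : ℕ) (hn : 5 ≤ n) (k : Type*) [Field k] :
    Algebra.adjoin k (bGens1 n k) = ⊤ ∧
    Module.finrank k (bCot n k) = (n - 1) * (n - 2) / 2 := by
  refine ⟨adjoin_bGens1 hn, ?_⟩
  rw [Module.finrank_eq_card_basis (Module.Basis.mk linearIndependent_cotGen (span_cotGen hn)),
    card_degOneVar n (by omega)]
end
end

section
/- Let n ≥ 6 and let k be any field. Then the prime spectrum of B_n(k) is an irreducible topological space (equivalently, the nilradical of B_n(k) is a prime ideal), and the Krull dimension of B_n(k) equals n + 1. This expresses that the moduli space M̄_{1,n}^∞ × Spec(k), whose homogeneous coordinate ring is B_n(k), is an irreducible projective variety of dimension n. -/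
noncomputable section

open MvPolynomial

theorem ringKrullDim_eq_of_isIntegral {R S : Type*} [CommRing R] [CommRing S] [Algebra R S]
    [Algebra.IsIntegral R S] (hinj : Function.Injective (algebraMap R S)) :
    ringKrullDim S = ringKrullDim R := by
  apply le_antisymm
  · refine Order.krullDim_le_of_strictMono (PrimeSpectrum.comap (algebraMap R S)) fun p q hpq => ?_
    exact Ideal.IsIntegral.comap_lt_comap (R := R) (I := p.asIdeal) (J := q.asIdeal) hpq
  · refine iSup_le fun l => ?_
    have : FaithfulSMul R S := (faithfulSMul_iff_algebraMap_injective R S).mpr hinj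
    obtain ⟨Q, -, hQ, hQl⟩ := Ideal.exists_ideal_over_prime_of_isIntegral (S := S) l.head.asIdeal ⊥
      (by rw [Ideal.comap_bot_of_injective _ hinj]; exact bot_le)
    have : Q.LiesOver l.head.asIdeal := ⟨hQl.symm⟩
    obtain ⟨L, hL, -⟩ := Ideal.exists_ltSeries_of_hasGoingUp l Q
    rw [← hL]
    exact le_iSup (fun p : LTSeries (PrimeSpectrum S) => (p.length : WithBot ℕ∞)) L

theorem ringKrullDim_eq_of_trdeg_eq {k A : Type*} [Field k] [CommRing A] [IsDomain A]
    [Algebra k A] [Algebra.FiniteType k A] {m : ℕ} (h : Algebra.trdeg k A = m) :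
    ringKrullDim A = m := by
  obtain ⟨s, g, ginj, gint⟩ := exists_integral_inj_algHom_of_fg k A
  let _ := g.toRingHom.toAlgebra
  have : Algebra.IsIntegral (MvPolynomial (Fin s) k) A := ⟨gint⟩
  have : IsScalarTower k (MvPolynomial (Fin s) k) A :=
    IsScalarTower.of_algebraMap_eq fun r => (g.commutes r).symm
  have hd := ringKrullDim_eq_of_isIntegral (R := MvPolynomial (Fin s) k) (S := A) ginj
  have : FaithfulSMul (MvPolynomial (Fin s) k) A :=
    (faithfulSMul_iff_algebraMap_injective _ _).mpr ginj
  have ht := lift_trdeg_add_eq k (MvPolynomial (Fin s) k) A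
  have h0 : Algebra.trdeg (MvPolynomial (Fin s) k) A = 0 := trdeg_eq_zero
  rw [h0, h, MvPolynomial.trdeg_of_isDomain] at ht
  have hs : s = m := by simpa using ht
  rw [hd, MvPolynomial.ringKrullDim_of_isNoetherianRing, hs]
  simp

theorem quadratic_eq_zero {R : Type*} [CommRing R] {p q r : R}
    (h : Polynomial.C p * Polynomial.X ^ 2 + Polynomial.C q * Polynomial.X + Polynomial.C r = 0) :
    p = 0 ∧ q = 0 ∧ r = 0 := by
  have h2 := congrArg (fun P => Polynomial.coeff P 2) h
  have h1 := congrArg (fun P => Polynomial.coeff P 1) h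
  have h0 := congrArg (fun P => Polynomial.coeff P 0) h
  simp [Polynomial.coeff_X, Polynomial.coeff_C] at h2 h1 h0
  exact ⟨h2, h1, h0⟩

/-- The plane cubic `x y (x + y + a) - c y - c̄ x = d`, as a polynomial in `y` over `K[x]`. -/
def cubicPoly {K : Type*} [Field K] (a c cb d : K) : Polynomial (Polynomial K) :=
  Polynomial.C Polynomial.X * Polynomial.X ^ 2 +
    Polynomial.C (Polynomial.X ^ 2 + Polynomial.C a * Polynomial.X - Polynomial.C c) *
      Polynomial.X + Polynomial.C (-(Polynomial.C cb * Polynomial.X + Polynomial.C d))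

section Cubic

variable {K : Type*} [Field K] {a c cb d : K}

theorem cubicPoly_natDegree : (cubicPoly a c cb d).natDegree = 2 :=
  Polynomial.natDegree_quadratic Polynomial.X_ne_zero

theorem cubicPoly_leadingCoeff : (cubicPoly a c cb d).leadingCoeff = Polynomial.X :=
  Polynomial.leadingCoeff_quadratic Polynomial.X_ne_zero

theorem cubicPoly_coeff_one : (cubicPoly a c cb d).coeff 1 =
    Polynomial.X ^ 2 + Polynomial.C a * Polynomial.X - Polynomial.C c := by
  simp only [cubicPoly, Polynomial.coeff_add, Polynomial.coeff_C_mul, Polynomial.coeff_C,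
    Polynomial.coeff_X_pow, Polynomial.coeff_X]
  simp

theorem cubicPoly_ne_zero : cubicPoly a c cb d ≠ 0 := by
  intro h
  have := cubicPoly_natDegree (a := a) (c := c) (cb := cb) (d := d)
  simp [h] at this

theorem cubic_content_unit (hc : c ≠ 0) {p : Polynomial K}
    (h : Polynomial.C p ∣ cubicPoly a c cb d) :
    IsUnit p := by
  rw [Polynomial.C_dvd_iff_dvd_coeff] at h
  have h2 : p ∣ Polynomial.X := by
    have := h 2
    rwa [← cubicPoly_natDegree (a := a) (c := c) (cb := cb) (d := d), Polynomial.coeff_natDegree,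
      cubicPoly_leadingCoeff] at this
  have h1 := h 1
  rw [cubicPoly_coeff_one] at h1
  have h3 : p ∣ Polynomial.C c := by
    have : Polynomial.C c = Polynomial.X * (Polynomial.X + Polynomial.C a) -
      (Polynomial.X ^ 2 + Polynomial.C a * Polynomial.X - Polynomial.C c) := by ring
    rw [this]
    exact dvd_sub (h2.mul_right _) h1
  exact isUnit_of_dvd_unit h3 (Polynomial.isUnit_C.mpr (isUnit_iff_ne_zero.mpr hc))

theorem cubic_no_linear_factor (hcb : cb ≠ 0) (hccb : c ≠ cb) {u : K} {q r s : Polynomial K}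
    (h2 : Polynomial.C u * r = Polynomial.X)
    (h1 : Polynomial.C u * s + q * r =
      Polynomial.X ^ 2 + Polynomial.C a * Polynomial.X - Polynomial.C c)
    (h0 : q * s = -(Polynomial.C cb * Polynomial.X + Polynomial.C d)) : False := by
  have hu : u ≠ 0 := by
    rintro rfl
    simp at h2
    exact Polynomial.X_ne_zero h2.symm
  have hdeg : (q * s).natDegree = 1 := by
    rw [h0, Polynomial.natDegree_neg, Polynomial.natDegree_linear hcb]
  have hqs : q * s ≠ 0 := by
    intro h; simp [h] at hdeg
  rw [Polynomial.natDegree_mul (left_ne_zero_of_mul hqs) (right_ne_zero_of_mul hqs)] at hdeg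
  have hq1 : q.natDegree ≤ 1 := by omega
  have hs1 : s.natDegree ≤ 1 := by omega
  obtain ⟨q1, q0, rfl⟩ := Polynomial.exists_eq_X_add_C_of_natDegree_le_one hq1
  obtain ⟨s1, s0, rfl⟩ := Polynomial.exists_eq_X_add_C_of_natDegree_le_one hs1
  obtain ⟨e2, e1, e0⟩ := quadratic_eq_zero (p := q1 - u) (q := u * u * s1 + q0 - u * a)
    (r := u * u * s0 + u * c) (by
      simp only [map_sub, map_add, map_mul]
      linear_combination Polynomial.C u * h1 -
        (Polynomial.C q1 * Polynomial.X + Polynomial.C q0) * h2)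
  obtain ⟨f2, f1, -⟩ := quadratic_eq_zero (p := q1 * s1) (q := q1 * s0 + q0 * s1 + cb)
    (r := q0 * s0 + d) (by
      simp only [map_add, map_mul]
      linear_combination h0)
  obtain rfl : q1 = u := sub_eq_zero.mp e2
  obtain rfl : s1 = 0 := (mul_eq_zero.mp f2).resolve_left hu
  apply hccb
  apply mul_left_cancel₀ hu
  linear_combination e0 - q1 * f1

theorem cubicPoly_prime (hc : c ≠ 0) (hcb : cb ≠ 0) (hccb : c ≠ cb) :
    Prime (cubicPoly a c cb d) := by
  rw [← irreducible_iff_prime]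
  refine ⟨fun h => ?_, fun P Q hPQ => ?_⟩
  · have := Polynomial.natDegree_eq_zero_of_isUnit h
    rw [cubicPoly_natDegree] at this
    omega
  have hP : P ≠ 0 := by rintro rfl; simp [cubicPoly_ne_zero] at hPQ
  have hQ : Q ≠ 0 := by rintro rfl; simp [cubicPoly_ne_zero] at hPQ
  have hdeg : P.natDegree + Q.natDegree = 2 := by
    rw [← Polynomial.natDegree_mul hP hQ, ← hPQ, cubicPoly_natDegree]
  have hunit : ∀ {P Q : Polynomial (Polynomial K)}, cubicPoly a c cb d = P * Q →
      P.natDegree = 0 → IsUnit P := by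
    intro P Q hPQ h
    rw [Polynomial.eq_C_of_natDegree_eq_zero h] at hPQ ⊢
    exact Polynomial.isUnit_C.mpr (cubic_content_unit hc (hPQ ▸ dvd_mul_right _ _))
  rcases Nat.eq_zero_or_pos P.natDegree with h | hP0
  · exact .inl (hunit hPQ h)
  rcases Nat.eq_zero_or_pos Q.natDegree with h | hQ0
  · exact .inr (hunit (hPQ.trans (mul_comm _ _)) h)
  exfalso
  obtain ⟨p, q, rfl⟩ := Polynomial.exists_eq_X_add_C_of_natDegree_le_one (p := P) (by omega)
  obtain ⟨r, s, rfl⟩ := Polynomial.exists_eq_X_add_C_of_natDegree_le_one (p := Q) (by omega)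
  rw [cubicPoly] at hPQ
  obtain ⟨h2, h1, h0⟩ := quadratic_eq_zero (p := p * r - Polynomial.X)
    (q := p * s + q * r - (Polynomial.X ^ 2 + Polynomial.C a * Polynomial.X - Polynomial.C c))
    (r := q * s + (Polynomial.C cb * Polynomial.X + Polynomial.C d)) (by
      simp only [map_sub, map_add, map_mul, map_neg] at hPQ ⊢
      linear_combination -hPQ)
  have h2 := sub_eq_zero.mp h2
  have h1 := sub_eq_zero.mp h1
  have h0 := eq_neg_of_add_eq_zero_left h0
  have hX : Irreducible (p * r) := h2 ▸ Polynomial.irreducible_X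
  rcases hX.isUnit_or_isUnit rfl with hu | hu
  · obtain ⟨u, -, rfl⟩ := Polynomial.isUnit_iff.mp hu
    exact cubic_no_linear_factor hcb hccb h2 h1 h0
  · obtain ⟨u, -, rfl⟩ := Polynomial.isUnit_iff.mp hu
    exact cubic_no_linear_factor (a := a) (d := d) (q := s) (r := p) (s := q) hcb hccb
      (by linear_combination h2)
      (by linear_combination h1) (by linear_combination h0)

/-- Polynomials in `x, y` whose monomials are not divisible by `x y²` are linearly independent
modulo the cubic. -/
theorem eq_zero_of_cubicPoly_dvd {f₀ f₁ h : Polynomial K}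
    (hdvd : cubicPoly a c cb d ∣ Polynomial.C f₀ + Polynomial.X * Polynomial.C f₁ +
      Polynomial.X ^ 2 * h.map Polynomial.C) : f₀ = 0 ∧ f₁ = 0 ∧ h = 0 := by
  have hlow : (Polynomial.C f₀ + Polynomial.X * Polynomial.C f₁).degree < 2 := by
    rw [add_comm, mul_comm]
    exact lt_of_le_of_lt Polynomial.degree_linear_le (by norm_num)
  have hh : h = 0 := by
    by_contra hh
    have hmap : h.map (Polynomial.C : K →+* Polynomial K) ≠ 0 :=
      (Polynomial.map_ne_zero_iff Polynomial.C_injective).mpr hh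
    have hlt : (Polynomial.C f₀ + Polynomial.X * Polynomial.C f₁).degree <
        (Polynomial.X ^ 2 * h.map (Polynomial.C : K →+* Polynomial K)).degree := by
      refine lt_of_lt_of_le hlow ?_
      rw [Polynomial.degree_mul, Polynomial.degree_X_pow]
      exact le_add_of_nonneg_right (Polynomial.zero_le_degree_iff.mpr hmap)
    obtain ⟨Q, hQ⟩ := hdvd
    have hl := congrArg Polynomial.leadingCoeff hQ
    rw [Polynomial.leadingCoeff_add_of_degree_lt hlt, Polynomial.leadingCoeff_mul,
      Polynomial.leadingCoeff_mul, cubicPoly_leadingCoeff, Polynomial.leadingCoeff_X_pow, one_mul,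
      Polynomial.leadingCoeff_map_of_injective Polynomial.C_injective] at hl
    have := congrArg (Polynomial.eval 0) hl
    simp [hh] at this
  subst hh
  simp only [Polynomial.map_zero, mul_zero, add_zero] at hdvd
  have hz := Polynomial.eq_zero_of_dvd_of_degree_lt hdvd (by
    rw [Polynomial.degree_eq_natDegree cubicPoly_ne_zero, cubicPoly_natDegree]; exact hlow)
  obtain ⟨-, h1, h0⟩ := quadratic_eq_zero (p := (0 : Polynomial K)) (q := f₁) (r := f₀) (by
    simp only [map_zero]; linear_combination hz)
  exact ⟨h0, h1, rfl⟩

end Cubic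

section Poles

/-- If `z` has a pole at a place where `u` is regular, then `u + z g(z) = 0` forces `g = 0`. Here
`S` is the graph of evaluation at that place. -/
theorem eq_zero_of_add_pole_mul_eq_zero {K L : Type*} [Field K] [Field L] (j : K →+* L)
    (S : Subring (L × K)) (hS : ∀ v, ((0, v) : L × K) ∈ S → v = 0) (hj : ∀ r, (j r, r) ∈ S)
    {z : L} (hz : z ≠ 0) (hzS : (z⁻¹, (0 : K)) ∈ S) {u : L} {v : K} (hu : (u, v) ∈ S)
    {g : Polynomial K} (h : u + z * g.eval₂ j z = 0) : g = 0 := by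
  rw [← Polynomial.leadingCoeff_eq_zero]
  have : Invertible z := invertibleOfNonzero hz
  have hrev : g.reverse.eval₂ j z⁻¹ * z ^ g.natDegree = g.eval₂ j z := by
    have := Polynomial.eval₂_reverse_mul_pow j z g
    rwa [invOf_eq_inv] at this
  have hmem : ∀ p : Polynomial K, (p.eval₂ j z⁻¹, p.eval 0) ∈ S := by
    intro p
    induction p using Polynomial.induction_on' with
    | add p q hp hq => simpa using S.add_mem hp hq
    | monomial m r =>
      have := S.mul_mem (hj r) (S.pow_mem hzS m)
      simpa [Polynomial.eval₂_monomial, Polynomial.eval_monomial] using this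
  have h1 := S.add_mem (hmem g.reverse) (S.mul_mem hu (S.pow_mem hzS (g.natDegree + 1)))
  apply hS
  convert h1 using 1
  ext
  · have hg : g.reverse.eval₂ j z⁻¹ = z⁻¹ ^ g.natDegree * g.eval₂ j z := by
      rw [← hrev, inv_pow, mul_comm, mul_assoc, mul_inv_cancel₀ (pow_ne_zero _ hz), mul_one]
    have hg' : g.eval₂ j z = - (z⁻¹ * u) := by
      field_simp
      linear_combination h
    simp only [Prod.mk_mul_mk, Prod.mk_add_mk, Prod.pow_mk, hg, hg']
    ring
  · simp [← Polynomial.coeff_zero_eq_eval_zero, Polynomial.coeff_zero_reverse]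

/-- Evaluation at a point `(p, q)` of the curve, as a subring of `L × K`. -/
def evalGraph {K L : Type*} [Field K] [Field L] (φ : Polynomial (Polynomial K) →+* L) (p q : K) :
    Subring (L × K) where
  carrier := {w | ∃ r s : Polynomial (Polynomial K), s.evalEval p q ≠ 0 ∧ w.1 * φ s = φ r ∧
    w.2 * s.evalEval p q = r.evalEval p q}
  mul_mem' := by
    rintro w w' ⟨r, s, hs, h1, h2⟩ ⟨r', s', hs', h1', h2'⟩
    refine ⟨r * r', s * s', ?_, ?_, ?_⟩
    · simp [hs, hs']
    · simp only [Prod.fst_mul, map_mul, ← h1, ← h1']; ring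
    · simp only [Prod.snd_mul, Polynomial.evalEval_mul, ← h2, ← h2']; ring
  one_mem' := ⟨1, 1, by simp, by simp, by simp⟩
  add_mem' := by
    rintro w w' ⟨r, s, hs, h1, h2⟩ ⟨r', s', hs', h1', h2'⟩
    refine ⟨r * s' + r' * s, s * s', ?_, ?_, ?_⟩
    · simp [hs, hs']
    · simp only [Prod.fst_add, map_mul, map_add, ← h1, ← h1']; ring
    · simp only [Prod.snd_add, Polynomial.evalEval_mul, Polynomial.evalEval_add, ← h2, ← h2']; ring
  zero_mem' := ⟨0, 1, by simp, by simp, by simp⟩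
  neg_mem' := by
    rintro w ⟨r, s, hs, h1, h2⟩
    exact ⟨-r, s, hs, by simp [h1], by simp [h2]⟩

/-- The numerator `(a + q + x + y) x - c` of the function with a pole at `(p, q)`. -/
def poleNum {K : Type*} [Field K] (a c q : K) : Polynomial (Polynomial K) :=
  (Polynomial.C (Polynomial.C a) + Polynomial.C (Polynomial.C q) + Polynomial.C Polynomial.X +
    Polynomial.X) * Polynomial.C Polynomial.X - Polynomial.C (Polynomial.C c)

theorem poleNum_evalEval {K : Type*} [Field K] (a c q p q' : K) :
    (poleNum a c q).evalEval p q' = (a + q + p + q') * p - c := by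
  simp [poleNum, Polynomial.evalEval]

theorem cubicPoly_evalEval {K : Type*} [Field K] (a c cb d p q : K) :
    (cubicPoly a c cb d).evalEval p q = p * q * (p + q + a) - c * q - cb * p - d := by
  simp [cubicPoly, Polynomial.evalEval]
  ring

theorem eval₂_coordX {K L : Type*} [Field K] [Field L] (φ : Polynomial (Polynomial K) →+* L)
    (f : Polynomial K) : f.eval₂ ((φ.comp Polynomial.C).comp Polynomial.C)
      (φ (Polynomial.C Polynomial.X)) = φ (Polynomial.C f) := by
  conv_rhs => rw [← Polynomial.eval₂_C_X (p := f), ← RingHom.comp_apply, Polynomial.hom_eval₂]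
  simp

theorem eval₂_coordY {K L : Type*} [Field K] [Field L] (φ : Polynomial (Polynomial K) →+* L)
    (f : Polynomial K) : f.eval₂ ((φ.comp Polynomial.C).comp Polynomial.C)
      (φ Polynomial.X) = φ (f.map Polynomial.C) := by
  conv_rhs => rw [← Polynomial.eval₂_C_X (p := f.map Polynomial.C), Polynomial.hom_eval₂,
    Polynomial.eval₂_map]

theorem eq_zero_of_normalForm_eq_zero {K L ι : Type*} [Field K] [Field L] {a c cb d : K}
    (φ : Polynomial (Polynomial K) →+* L) (hφ : ∀ P, φ P = 0 → cubicPoly a c cb d ∣ P)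
    [Fintype ι] (p q : ι → K) (hp : Function.Injective p)
    (hpq : ∀ i, p i * q i * (p i + q i + a) - c * q i - cb * p i - d = 0)
    (hpole : ∀ i, (a + q i + p i + q i) * p i - c ≠ 0) (z : ι → L)
    (hz : ∀ i, z i * φ (Polynomial.C (Polynomial.X - Polynomial.C (p i))) = φ (poleNum a c (q i)))
    (f₀ f₁ h : Polynomial K) (g : ι → Polynomial K)
    (h0 : f₀.eval₂ ((φ.comp Polynomial.C).comp Polynomial.C) (φ (Polynomial.C Polynomial.X)) +
      φ Polynomial.X *
        f₁.eval₂ ((φ.comp Polynomial.C).comp Polynomial.C) (φ (Polynomial.C Polynomial.X)) +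
      φ Polynomial.X ^ 2 * h.eval₂ ((φ.comp Polynomial.C).comp Polynomial.C) (φ Polynomial.X) +
      ∑ i, z i * (g i).eval₂ ((φ.comp Polynomial.C).comp Polynomial.C) (z i) = 0) :
    f₀ = 0 ∧ f₁ = 0 ∧ h = 0 ∧ ∀ i, g i = 0 := by
  classical
  set j := (φ.comp Polynomial.C).comp Polynomial.C with hj
  have hev : ∀ i P, φ P = 0 → P.evalEval (p i) (q i) = 0 := by
    intro i P hP
    obtain ⟨Q, rfl⟩ := hφ P hP
    rw [Polynomial.evalEval_mul, cubicPoly_evalEval, hpq, zero_mul]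
  rw [eval₂_coordX, eval₂_coordX, eval₂_coordY] at h0
  have hg : ∀ i, g i = 0 := by
    intro i
    have hS : ∀ v, ((0, v) : L × K) ∈ evalGraph φ (p i) (q i) → v = 0 := by
      rintro v ⟨r, s, hs, h1, h2⟩
      rw [zero_mul] at h1
      simp only [hev i r h1.symm, mul_eq_zero, hs, or_false] at h2
      exact h2
    have hφS : ∀ P, (φ P, P.evalEval (p i) (q i)) ∈ evalGraph φ (p i) (q i) :=
      fun P => ⟨P, 1, by simp, by simp, by simp⟩
    have hjS : ∀ r, (j r, r) ∈ evalGraph φ (p i) (q i) := by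
      intro r
      have := hφS (Polynomial.C (Polynomial.C r))
      simp only [Polynomial.evalEval, Polynomial.eval_C] at this
      exact this
    have hN : (poleNum a c (q i)).evalEval (p i) (q i) ≠ 0 := by
      rw [poleNum_evalEval]; exact hpole i
    have hφN : φ (poleNum a c (q i)) ≠ 0 := fun h => hN (hev i _ h)
    have hzi : z i ≠ 0 := by
      intro h
      rw [← hz i, h, zero_mul] at hφN
      exact hφN rfl
    have hzS : ((z i)⁻¹, (0 : K)) ∈ evalGraph φ (p i) (q i) := by
      refine ⟨Polynomial.C (Polynomial.X - Polynomial.C (p i)), poleNum a c (q i), hN, ?_, ?_⟩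
      · rw [← hz i, inv_mul_cancel_left₀ hzi]
      · simp [Polynomial.evalEval]
    have hzS' : ∀ k, k ≠ i → ∃ v, (z k, v) ∈ evalGraph φ (p i) (q i) := by
      intro k hk
      have hne : p i - p k ≠ 0 := sub_ne_zero.mpr fun h => hk (hp h).symm
      refine ⟨(poleNum a c (q k)).evalEval (p i) (q i) / (p i - p k), poleNum a c (q k),
        Polynomial.C (Polynomial.X - Polynomial.C (p k)), ?_, hz k, ?_⟩
      · simpa [Polynomial.evalEval] using hne
      · simp only [Polynomial.evalEval_C, Polynomial.eval_sub, Polynomial.eval_X,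
          Polynomial.eval_C]
        exact div_mul_cancel₀ _ hne
    have hreg : ∀ k, k ≠ i → z k * (g k).eval₂ j (z k) ∈
        (evalGraph φ (p i) (q i)).map (RingHom.fst L K) := by
      intro k hk
      obtain ⟨v, hv⟩ := hzS' k hk
      have hzk : z k ∈ (evalGraph φ (p i) (q i)).map (RingHom.fst L K) := ⟨_, hv, rfl⟩
      refine Subring.mul_mem _ hzk ?_
      rw [Polynomial.eval₂_eq_sum_range]
      exact Subring.sum_mem _ fun m _ =>
        Subring.mul_mem _ ⟨_, hjS _, rfl⟩ (Subring.pow_mem _ hzk m)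
    have hφreg : ∀ P, φ P ∈ (evalGraph φ (p i) (q i)).map (RingHom.fst L K) :=
      fun P => ⟨_, hφS P, rfl⟩
    obtain ⟨⟨u, v⟩, huv, hu⟩ := Subring.add_mem _
      (hφreg (Polynomial.C f₀ + Polynomial.X * Polynomial.C f₁ +
        Polynomial.X ^ 2 * h.map Polynomial.C))
      (Subring.sum_mem _ (t := Finset.univ.erase i) (f := fun k => z k * (g k).eval₂ j (z k))
        fun k hk => hreg k (Finset.ne_of_mem_erase hk))
    refine eq_zero_of_add_pole_mul_eq_zero j _ hS hjS hzi hzS huv ?_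
    rw [← Finset.sum_erase_add _ _ (Finset.mem_univ i)] at h0
    simp only [RingHom.coe_fst] at hu
    rw [hu, ← h0]
    simp only [map_add, map_mul, map_pow]
    ring
  have hsum : ∑ i, z i * (g i).eval₂ j (z i) = 0 := Finset.sum_eq_zero fun i _ => by
    rw [hg i]; simp
  rw [hsum, add_zero, ← map_pow, ← map_mul, ← map_mul, ← map_add, ← map_add] at h0
  obtain ⟨e0, e1, e2⟩ := eq_zero_of_cubicPoly_dvd (hφ _ h0)
  exact ⟨e0, e1, e2, hg⟩

end Poles

section Spanning

variable {D C ι : Type*} [CommRing D] [CommRing C] [Algebra D C]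

/-- The span of the monomials in `x, y` and of the powers of the `z i`. -/
def monomialSpan (D : Type*) {C ι : Type*} [CommRing D] [CommRing C] [Algebra D C]
    (x y : C) (z : ι → C) : Submodule D C :=
  Submodule.span D ({w | ∃ i j : ℕ, w = x ^ i * y ^ j} ∪ {w | ∃ i, ∃ m : ℕ, w = z i ^ m})

theorem algebraMap_mul_mem (M : Submodule D C) (r : D) {w : C} (hw : w ∈ M) :
    algebraMap D C r * w ∈ M := by
  rw [← Algebra.smul_def]; exact M.smul_mem r hw

theorem monomial_mem_monomialSpan (x y : C) (z : ι → C) (i j : ℕ) :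
    x ^ i * y ^ j ∈ monomialSpan D x y z :=
  Submodule.subset_span (.inl ⟨i, j, rfl⟩)

theorem pow_mem_monomialSpan (x y : C) (z : ι → C) (i : ι) (m : ℕ) :
    z i ^ m ∈ monomialSpan D x y z :=
  Submodule.subset_span (.inr ⟨i, m, rfl⟩)

variable {x y : C} {z : ι → C} {a c cb : D} {p q : ι → D} {e : ι → ι → D}

theorem pow_mul_monomial_mem_monomialSpan
    (hxz : ∀ i, x * z i = algebraMap D C (p i) * z i +
      (algebraMap D C a + algebraMap D C (q i) + x + y) * x - algebraMap D C c)
    (hyz : ∀ i, y * z i = algebraMap D C (q i) * z i -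
      (algebraMap D C a + algebraMap D C (p i) + algebraMap D C (q i) + x) * algebraMap D C (q i) +
      algebraMap D C cb) (k : ι) (m i j : ℕ) :
    z k ^ m * (x ^ i * y ^ j) ∈ monomialSpan D x y z := by
  induction m generalizing i j with
  | zero => simpa using monomial_mem_monomialSpan x y z i j
  | succ m ihm =>
    induction i with
    | zero =>
      induction j with
      | zero => simpa using pow_mem_monomialSpan x y z k (m + 1)
      | succ j ihj =>
        have : z k ^ (m + 1) * (x ^ 0 * y ^ (j + 1)) =
            algebraMap D C (q k) * (z k ^ (m + 1) * (x ^ 0 * y ^ j)) +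
            algebraMap D C (cb - (a + p k + q k) * q k) * (z k ^ m * (x ^ 0 * y ^ j)) +
            algebraMap D C (-(q k)) * (z k ^ m * (x ^ 1 * y ^ j)) := by
          simp only [map_sub, map_mul, map_add, map_neg]
          linear_combination (z k ^ m * y ^ j) * hyz k
        rw [this]
        exact add_mem (add_mem (algebraMap_mul_mem _ _ ihj) (algebraMap_mul_mem _ _ (ihm _ _)))
          (algebraMap_mul_mem _ _ (ihm _ _))
    | succ i ihi =>
      have : z k ^ (m + 1) * (x ^ (i + 1) * y ^ j) =
          algebraMap D C (p k) * (z k ^ (m + 1) * (x ^ i * y ^ j)) +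
          algebraMap D C (a + q k) * (z k ^ m * (x ^ (i + 1) * y ^ j)) +
          algebraMap D C (-c) * (z k ^ m * (x ^ i * y ^ j)) +
          z k ^ m * (x ^ (i + 2) * y ^ j) + z k ^ m * (x ^ (i + 1) * y ^ (j + 1)) := by
        simp only [map_add, map_neg]
        linear_combination (z k ^ m * x ^ i * y ^ j) * hxz k
      rw [this]
      exact add_mem (add_mem (add_mem (add_mem (algebraMap_mul_mem _ _ ihi)
        (algebraMap_mul_mem _ _ (ihm _ _))) (algebraMap_mul_mem _ _ (ihm _ _))) (ihm _ _)) (ihm _ _)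

theorem mul_mem_monomialSpan
    (hxz : ∀ i, x * z i = algebraMap D C (p i) * z i +
      (algebraMap D C a + algebraMap D C (q i) + x + y) * x - algebraMap D C c)
    (hyz : ∀ i, y * z i = algebraMap D C (q i) * z i -
      (algebraMap D C a + algebraMap D C (p i) + algebraMap D C (q i) + x) * algebraMap D C (q i) +
      algebraMap D C cb)
    (hzz : ∀ i j, i ≠ j → z i * z j = algebraMap D C (e i j) * z j + algebraMap D C (e j i) * z i +
      (algebraMap D C a + x + y) * x - algebraMap D C c)
    {w : C} (hw : w ∈ monomialSpan D x y z) :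
    x * w ∈ monomialSpan D x y z ∧ y * w ∈ monomialSpan D x y z ∧
      ∀ i, z i * w ∈ monomialSpan D x y z := by
  have key := pow_mul_monomial_mem_monomialSpan (D := D) hxz hyz
  have keyz : ∀ i j m, z i * z j ^ m ∈ monomialSpan D x y z := by
    intro i j m
    by_cases hij : i = j
    · rw [hij, ← pow_succ']; exact pow_mem_monomialSpan x y z j (m + 1)
    induction m with
    | zero => simpa using pow_mem_monomialSpan x y z i 1
    | succ m ih =>
      have : z i * z j ^ (m + 1) = algebraMap D C (e i j) * (z j ^ (m + 1)) +
          algebraMap D C (e j i) * (z i * z j ^ m) +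
          algebraMap D C a * (z j ^ m * (x ^ 1 * y ^ 0)) + z j ^ m * (x ^ 2 * y ^ 0) +
          z j ^ m * (x ^ 1 * y ^ 1) + algebraMap D C (-c) * (z j ^ m * (x ^ 0 * y ^ 0)) := by
        simp only [map_neg]
        linear_combination (z j ^ m) * hzz i j hij
      rw [this]
      exact add_mem (add_mem (add_mem (add_mem (add_mem
        (algebraMap_mul_mem _ _ (pow_mem_monomialSpan x y z j _)) (algebraMap_mul_mem _ _ ih))
        (algebraMap_mul_mem _ _ (key _ _ _ _))) (key _ _ _ _)) (key _ _ _ _))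
        (algebraMap_mul_mem _ _ (key _ _ _ _))
  induction hw using Submodule.span_induction with
  | mem w hw =>
    rcases hw with ⟨i, j, rfl⟩ | ⟨i, m, rfl⟩
    · refine ⟨?_, ?_, fun k => ?_⟩
      · convert monomial_mem_monomialSpan (D := D) x y z (i + 1) j using 1; ring
      · convert monomial_mem_monomialSpan (D := D) x y z i (j + 1) using 1; ring
      · simpa using key k 1 i j
    · refine ⟨?_, ?_, fun k => keyz k i m⟩
      · convert key i m 1 0 using 1; ring
      · convert key i m 0 1 using 1; ring
  | zero => simp
  | add w w' _ _ h h' =>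
    simp only [mul_add]
    exact ⟨add_mem h.1 h'.1, add_mem h.2.1 h'.2.1, fun i => add_mem (h.2.2 i) (h'.2.2 i)⟩
  | smul r w _ h =>
    simp only [mul_smul_comm]
    exact ⟨Submodule.smul_mem _ _ h.1, Submodule.smul_mem _ _ h.2.1,
      fun i => Submodule.smul_mem _ _ (h.2.2 i)⟩

/-- The elements `f₀(x) + y f₁(x) + y² h(y) + ∑ zᵢ gᵢ(zᵢ)`. -/
def normalForms (D : Type*) {C ι : Type*} [CommRing D] [CommRing C] [Algebra D C] [Fintype ι]
    (x y : C) (z : ι → C) : Submodule D C where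
  carrier := {w | ∃ (f₀ f₁ h : Polynomial D) (g : ι → Polynomial D),
    w = Polynomial.aeval x f₀ + y * Polynomial.aeval x f₁ + y ^ 2 * Polynomial.aeval y h +
      ∑ i, z i * Polynomial.aeval (z i) (g i)}
  add_mem' := by
    rintro _ _ ⟨f₀, f₁, h, g, rfl⟩ ⟨f₀', f₁', h', g', rfl⟩
    refine ⟨f₀ + f₀', f₁ + f₁', h + h', fun i => g i + g' i, ?_⟩
    simp only [map_add, mul_add, Finset.sum_add_distrib]
    ring
  zero_mem' := ⟨0, 0, 0, fun _ => 0, by simp⟩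
  smul_mem' := by
    rintro r _ ⟨f₀, f₁, h, g, rfl⟩
    refine ⟨r • f₀, r • f₁, r • h, fun i => r • g i, ?_⟩
    simp only [map_smul, smul_add, mul_smul_comm, Finset.smul_sum]

theorem monomialSpan_le_normalForms [Fintype ι] {d : D}
    (hcubic : x * y ^ 2 = -(x ^ 2 * y) - algebraMap D C a * (x * y) + algebraMap D C c * y +
      algebraMap D C cb * x + algebraMap D C d) :
    monomialSpan D x y z ≤ normalForms D x y z := by
  classical
  rw [monomialSpan, Submodule.span_le]
  have hx : ∀ i : ℕ, x ^ i ∈ normalForms D x y z := fun i =>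
    ⟨Polynomial.X ^ i, 0, 0, fun _ => 0, by simp⟩
  rintro _ (⟨i, j, rfl⟩ | ⟨i, m, rfl⟩)
  · show x ^ i * y ^ j ∈ normalForms D x y z
    induction j using Nat.strong_induction_on generalizing i with
    | _ j ih =>
      match j, ih with
      | 0, _ => simpa using hx i
      | 1, _ => exact ⟨0, Polynomial.X ^ i, 0, fun _ => 0, by simp [mul_comm]⟩
      | j + 2, ih =>
        match i with
        | 0 => exact ⟨0, 0, Polynomial.X ^ j, fun _ => 0, by simp; ring⟩
        | i + 1 =>
          have : x ^ (i + 1) * y ^ (j + 2) = algebraMap D C (-1) * (x ^ (i + 2) * y ^ (j + 1)) +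
              algebraMap D C (-a) * (x ^ (i + 1) * y ^ (j + 1)) +
              algebraMap D C c * (x ^ i * y ^ (j + 1)) +
              algebraMap D C cb * (x ^ (i + 1) * y ^ j) + algebraMap D C d * (x ^ i * y ^ j) := by
            simp only [map_neg, map_one]
            linear_combination (x ^ i * y ^ j) * hcubic
          rw [this]
          have h1 := fun i => ih (j + 1) (by omega) i
          have h0 := fun i => ih j (by omega) i
          exact add_mem (add_mem (add_mem (add_mem (algebraMap_mul_mem _ _ (h1 _))
            (algebraMap_mul_mem _ _ (h1 _))) (algebraMap_mul_mem _ _ (h1 _)))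
            (algebraMap_mul_mem _ _ (h0 _))) (algebraMap_mul_mem _ _ (h0 _))
  · show z i ^ m ∈ normalForms D x y z
    match m with
    | 0 => simpa using hx 0
    | m + 1 =>
      refine ⟨0, 0, 0, Pi.single i (Polynomial.X ^ m), ?_⟩
      rw [Finset.sum_eq_single i (fun k _ hk => by simp [hk]) (by simp)]
      simp [pow_succ']

end Spanning

section Extension

universe u

theorem exists_field_of_prime {A : Type u} [CommRing A] {G : A} (hG : Prime G) :
    ∃ (L : Type u) (_ : Field L) (φ : A →+* L), ∀ P, φ P = 0 ↔ G ∣ P := by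
  have : (Ideal.span {G}).IsPrime := (Ideal.span_singleton_prime hG.ne_zero).mpr hG
  refine ⟨FractionRing (A ⧸ Ideal.span {G}), inferInstance,
    (algebraMap (A ⧸ Ideal.span {G}) (FractionRing (A ⧸ Ideal.span {G}))).comp
      (Ideal.Quotient.mk (Ideal.span {G})), fun P => ?_⟩
  rw [RingHom.comp_apply, map_eq_zero_iff _ (IsFractionRing.injective _ _),
    Ideal.Quotient.eq_zero_iff_mem, Ideal.mem_span_singleton]

/-- The relations between the coordinates `x, y, z i` of a further point on the curve with
coefficients `a, c, c̄` and marked points `(p i, q i)`. -/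
structure PointRelations {A ι : Type*} [CommRing A] (a c cb : A) (p q : ι → A) (e : ι → ι → A)
    (x y : A) (z : ι → A) : Prop where
  x_mul : ∀ i, x * z i = p i * z i + (a + q i + x + y) * x - c
  y_mul : ∀ i, y * z i = q i * z i - (a + p i + q i + x) * q i + cb
  z_mul : ∀ i j, i ≠ j → z i * z j = e i j * z j + e j i * z i + (a + x + y) * x - c

/-- The relations between the coordinates of the marked points. -/
structure MarkingRelations {A ι : Type*} [CommRing A] (a c cb : A) (p q : ι → A)
    (e : ι → ι → A) (d : A) : Prop where
  p_mul : ∀ i j, i ≠ j → (p j - p i) * e i j = (a + q i + p j + q j) * p j - c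
  q_mul : ∀ i j, i ≠ j → (q i - q j) * e i j = (a + p i + q i + p j) * q i - cb
  add_swap : ∀ i j, i ≠ j → e i j + e j i = a + p i + q i + p j + q j
  curve : ∀ i, p i * q i * (p i + q i + a) - c * q i - cb * p i = d

theorem MarkingRelations.map {A B ι : Type*} [CommRing A] [CommRing B] {a c cb : A} {p q : ι → A}
    {e : ι → ι → A} {d : A} (h : MarkingRelations a c cb p q e d) (f : A →+* B) :
    MarkingRelations (f a) (f c) (f cb) (fun i => f (p i)) (fun i => f (q i))
      (fun i j => f (e i j)) (f d) where
  p_mul i j hij := by simpa using congrArg f (h.p_mul i j hij)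
  q_mul i j hij := by simpa using congrArg f (h.q_mul i j hij)
  add_swap i j hij := by simpa using congrArg f (h.add_swap i j hij)
  curve i := by simpa using congrArg f (h.curve i)

theorem PointRelations.of_div {L ι : Type*} [Field L] {a c cb d : L} {p q : ι → L}
    {e : ι → ι → L} (h : MarkingRelations a c cb p q e d) {x y : L}
    (hxy : x * y * (x + y + a) - c * y - cb * x = d) (hx : ∀ i, x ≠ p i) :
    PointRelations a c cb p q e x y (fun i => ((a + q i + x + y) * x - c) / (x - p i)) where
  x_mul i := by
    have := sub_ne_zero.mpr (hx i)
    field_simp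
    ring
  y_mul i := by
    have := sub_ne_zero.mpr (hx i)
    field_simp
    linear_combination hxy - h.curve i
  z_mul i j hij := by
    have hi := sub_ne_zero.mpr (hx i)
    have hj := sub_ne_zero.mpr (hx j)
    have hs : e j i = a + p i + q i + p j + q j - e i j := by
      linear_combination h.add_swap i j hij
    rw [hs]
    field_simp
    linear_combination x * hxy - ((a + x + y) * x - c) * h.p_mul i j hij +
      x * (x - p i) * h.q_mul i j hij - x * q i * h.p_mul i j hij - x * h.curve i

theorem PointRelations.cubic {A ι : Type*} [CommRing A] {a c cb d : A} {p q : ι → A}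
    {e : ι → ι → A} {x y : A} {z : ι → A} (h : PointRelations a c cb p q e x y z)
    (h' : MarkingRelations a c cb p q e d) (i : ι) :
    x * y ^ 2 = -(x ^ 2 * y) - a * (x * y) + c * y + cb * x + d := by
  linear_combination -(y * h.x_mul i) + x * h.y_mul i - p i * h.y_mul i + q i * h.x_mul i +
    h'.curve i

variable {D C : Type u} {ι : Type*} [CommRing D] [IsDomain D] [CommRing C] [Algebra D C]
  {a c cb d : D} {p q : ι → D} {e : ι → ι → D} {x y : C} {z : ι → C}

/-- Adjoining a further point to a generically smooth marked curve over a domain: it is a domain in which normal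
forms are unique. -/
theorem isDomain_and_normalForm_unique_of_universal [Fintype ι] [Nonempty ι]
    (hmark : MarkingRelations a c cb p q e d)
    (hc : c ≠ 0) (hcb : cb ≠ 0) (hccb : c ≠ cb) (hp : Function.Injective p)
    (hpole : ∀ i, (a + q i + p i + q i) * p i - c ≠ 0)
    (hpt : PointRelations (algebraMap D C a) (algebraMap D C c) (algebraMap D C cb)
      (fun i => algebraMap D C (p i)) (fun i => algebraMap D C (q i))
      (fun i j => algebraMap D C (e i j)) x y z)
    (hspan : monomialSpan D x y z = ⊤)
    (huniv : ∀ (L : Type u) [Field L] (J : D →+* L) (x' y' : L) (z' : ι → L),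
      PointRelations (J a) (J c) (J cb) (fun i => J (p i)) (fun i => J (q i))
        (fun i j => J (e i j)) x' y' z' →
      ∃ ψ : C →+* L, ψ.comp (algebraMap D C) = J ∧ ψ x = x' ∧ ψ y = y' ∧ ∀ i, ψ (z i) = z' i) :
    IsDomain C ∧ ∀ f₀ f₁ : Polynomial D, Polynomial.aeval x f₀ + y * Polynomial.aeval x f₁ = 0 →
      f₀ = 0 ∧ f₁ = 0 := by
  let K := FractionRing D
  have hinj : Function.Injective (algebraMap D K) := IsFractionRing.injective D K
  obtain ⟨L, _, φ, hφ⟩ := exists_field_of_prime (cubicPoly_prime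
    (a := algebraMap D K a) (c := algebraMap D K c) (cb := algebraMap D K cb)
    (d := algebraMap D K d) ((map_ne_zero_iff _ hinj).mpr hc) ((map_ne_zero_iff _ hinj).mpr hcb)
    (hinj.ne hccb))
  let j : K →+* L := (φ.comp Polynomial.C).comp Polynomial.C
  let X' := φ (Polynomial.C Polynomial.X)
  let Y' := φ Polynomial.X
  have hx : ∀ i, X' ≠ j (algebraMap D K (p i)) := by
    intro i h
    have h0 : φ (Polynomial.C (Polynomial.X - Polynomial.C (algebraMap D K (p i)))) = 0 := by
      rw [map_sub, map_sub]; exact sub_eq_zero.mpr h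
    have hdvd := (hφ _).mp h0
    have := (eq_zero_of_cubicPoly_dvd
      (f₀ := Polynomial.X - Polynomial.C (algebraMap D K (p i))) (f₁ := 0) (h := 0)
      (by simpa using hdvd)).1
    exact Polynomial.X_sub_C_ne_zero _ this
  have hXY : X' * Y' * (X' + Y' + j (algebraMap D K a)) - j (algebraMap D K c) * Y' -
      j (algebraMap D K cb) * X' = j (algebraMap D K d) := by
    have := (hφ _).mpr (dvd_refl _)
    simp only [cubicPoly, map_add, map_mul, map_pow, map_sub, map_neg] at this
    show φ _ * φ _ * (φ _ + φ _ + φ _) - φ _ * φ _ - φ _ * φ _ = φ _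
    linear_combination this
  have hrel := PointRelations.of_div ((hmark.map (algebraMap D K)).map j) hXY hx
  obtain ⟨ψ, hψ, hψx, hψy, hψz⟩ := huniv L (j.comp (algebraMap D K)) X' Y' _ hrel
  have hcub := hpt.cubic (hmark.map (algebraMap D C)) (Classical.arbitrary ι)
  have hform : ∀ (f₀ f₁ h : Polynomial D) (g : ι → Polynomial D),
      ψ (Polynomial.aeval x f₀ + y * Polynomial.aeval x f₁ + y ^ 2 * Polynomial.aeval y h +
        ∑ i, z i * Polynomial.aeval (z i) (g i)) = 0 →
      f₀ = 0 ∧ f₁ = 0 ∧ h = 0 ∧ ∀ i, g i = 0 := by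
    intro f₀ f₁ h g h0
    have haeval : ∀ (w : C) (f : Polynomial D), ψ (Polynomial.aeval w f) =
        (f.map (algebraMap D K)).eval₂ j (ψ w) := by
      intro w f
      rw [Polynomial.aeval_def, Polynomial.hom_eval₂, hψ, Polynomial.eval₂_map]
    simp only [map_add, map_mul, map_pow, map_sum, haeval, hψx, hψy, hψz] at h0
    have := eq_zero_of_normalForm_eq_zero φ (fun P hP => (hφ P).mp hP)
      (fun i => algebraMap D K (p i)) (fun i => algebraMap D K (q i)) (hinj.comp hp)
      (fun i => by
        rw [sub_eq_zero]
        simpa using (hmark.map (algebraMap D K)).curve i)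
      (fun i => by simpa using (map_ne_zero_iff _ hinj).mpr (hpole i)) _
      (fun i => by
        have := sub_ne_zero.mpr (hx i)
        have hden : φ (Polynomial.C (Polynomial.X - Polynomial.C (algebraMap D K (p i)))) =
          X' - j (algebraMap D K (p i)) := by rw [map_sub, map_sub]; rfl
        rw [hden, div_mul_cancel₀ _ this]
        simp only [poleNum, map_add, map_mul, map_sub]
        rfl)
      _ _ _ _ h0
    simpa only [Polynomial.map_eq_zero_iff hinj] using this
  have hψinj : Function.Injective ψ := by
    rw [injective_iff_map_eq_zero]
    intro w hw
    have hmem : w ∈ normalForms D x y z := monomialSpan_le_normalForms hcub (hspan ▸ trivial)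
    obtain ⟨f₀, f₁, h, g, rfl⟩ := hmem
    obtain ⟨rfl, rfl, rfl, hg⟩ := hform _ _ _ _ hw
    simp [hg]
  refine ⟨hψinj.isDomain ψ, fun f₀ f₁ hf => ?_⟩
  have := hform f₀ f₁ 0 (fun _ => 0) (by simpa using congrArg ψ hf)
  exact ⟨this.1, this.2.1⟩

theorem trdeg_eq_one_of_pointRelations [IsDomain C] [Nonempty ι]
    (hmark : MarkingRelations a c cb p q e d)
    (hpt : PointRelations (algebraMap D C a) (algebraMap D C c) (algebraMap D C cb)
      (fun i => algebraMap D C (p i)) (fun i => algebraMap D C (q i))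
      (fun i j => algebraMap D C (e i j)) x y z)
    (hspan : monomialSpan D x y z = ⊤) (hx : Transcendental D x) :
    Algebra.trdeg D C = 1 := by
  have hcub := hpt.cubic (hmark.map (algebraMap D C)) (Classical.arbitrary ι)
  have : Algebra.Transcendental D C := ⟨x, hx⟩
  apply le_antisymm
  · let S := Subalgebra.algebraicClosure (Algebra.adjoin D {x}) C
    have hxA : x ∈ Algebra.adjoin D {x} := Algebra.subset_adjoin rfl
    have hadj : ∀ w ∈ Algebra.adjoin D {x}, w ∈ S := fun w hw =>
      S.algebraMap_mem (⟨w, hw⟩ : Algebra.adjoin D {x})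
    have hD : ∀ r : D, algebraMap D C r ∈ Algebra.adjoin D {x} := fun r =>
      Subalgebra.algebraMap_mem _ r
    have hxS : x ∈ S := hadj x hxA
    have hDS : ∀ r : D, algebraMap D C r ∈ S := fun r => hadj _ (hD r)
    have hyS : y ∈ S := by
      refine ⟨Polynomial.C ⟨x, hxA⟩ * Polynomial.X ^ 2 +
        Polynomial.C (⟨x, hxA⟩ ^ 2 + ⟨_, hD a⟩ * ⟨x, hxA⟩ - ⟨_, hD c⟩) * Polynomial.X +
        Polynomial.C (-(⟨_, hD cb⟩ * ⟨x, hxA⟩ + ⟨_, hD d⟩)), ?_, ?_⟩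
      · intro h
        have h0 := congrArg Subtype.val (quadratic_eq_zero h).1
        exact hx (by rw [show x = 0 from h0]; exact isAlgebraic_zero)
      · simp only [map_add, map_mul, map_pow, map_sub, map_neg, Polynomial.aeval_C,
          Polynomial.aeval_X]
        show x * y ^ 2 + (x ^ 2 + algebraMap D C a * x - algebraMap D C c) * y +
          -(algebraMap D C cb * x + algebraMap D C d) = 0
        linear_combination hcub
    have hzS : ∀ i, z i ∈ S := by
      intro i
      have hne : x - algebraMap D C (p i) ≠ 0 := by
        intro h
        apply hx
        rw [sub_eq_zero.mp h]
        exact isAlgebraic_algebraMap _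
      refine IsAlgebraic.of_mul (mem_nonZeroDivisors_of_ne_zero hne)
        (S.sub_mem hxS (hDS _)) ?_
      have : (x - algebraMap D C (p i)) * z i =
          (algebraMap D C a + algebraMap D C (q i) + x + y) * x - algebraMap D C c := by
        linear_combination hpt.x_mul i
      rw [this]
      exact S.sub_mem (S.mul_mem (S.add_mem (S.add_mem (S.add_mem (hDS _) (hDS _)) hxS) hyS) hxS)
        (hDS _)
    have hle : monomialSpan D x y z ≤ (S.restrictScalars D).toSubmodule := by
      rw [monomialSpan, Submodule.span_le]
      rintro _ (⟨i, j, rfl⟩ | ⟨i, m, rfl⟩)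
      · exact S.mul_mem (S.pow_mem hxS i) (S.pow_mem hyS j)
      · exact S.pow_mem (hzS i) m
    have : Algebra.IsAlgebraic (Algebra.adjoin D {x}) C :=
      ⟨fun w => hle (hspan ▸ Submodule.mem_top)⟩
    simpa using Algebra.IsAlgebraic.trdeg_le_cardinalMk D (s := {x})
  · rw [Cardinal.one_le_iff_pos]
    exact trdeg_pos D C

end Extension

section Generators

/-- A solution of the relations (R1), (R2), (R3) in a commutative ring. -/
structure BSolution {L : Type*} [CommRing L] (n : ℕ) (a c cb : L) (lo hi : ℕ → L)
    (mix : ℕ → ℕ → L) : Prop where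
  lo_mul : ∀ i j, 4 ≤ i → i < j → j ≤ n →
    (lo j - lo i) * mix i j = (a + hi i + lo j + hi j) * lo j - c
  hi_mul : ∀ i j, 4 ≤ i → i < j → j ≤ n →
    (hi i - hi j) * mix i j = (a + lo i + hi i + lo j) * hi i - cb
  mix_mul : ∀ i j k, 4 ≤ i → i < j → j < k → k ≤ n →
    mix i j * mix j k + (a + lo i + hi i + lo j + hi j - mix i j) * mix i k - mix i k * mix j k +
      (a + lo k + hi k) * lo k = c

/-- The element `c_{ij}` for arbitrary distinct indices. -/
def mixAll {L : Type*} [CommRing L] (a : L) (lo hi : ℕ → L) (mix : ℕ → ℕ → L) (i j : ℕ) : L :=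
  if i < j then mix i j else a + lo j + hi j + lo i + hi i - mix j i

theorem map_mixAll {L L' : Type*} [CommRing L] [CommRing L'] (f : L →+* L') (a : L)
    (lo hi : ℕ → L) (mix : ℕ → ℕ → L) (i j : ℕ) :
    f (mixAll a lo hi mix i j) =
      mixAll (f a) (fun i => f (lo i)) (fun i => f (hi i)) (fun i j => f (mix i j)) i j := by
  unfold mixAll
  split_ifs <;> simp

namespace BSolution

variable {L L' : Type*} [CommRing L] [CommRing L'] {n : ℕ} {a c cb : L} {lo hi : ℕ → L}
  {mix : ℕ → ℕ → L}

theorem mono {m : ℕ} (h : BSolution n a c cb lo hi mix) (hmn : m ≤ n) :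
    BSolution m a c cb lo hi mix where
  lo_mul i j h1 h2 h3 := h.lo_mul i j h1 h2 (h3.trans hmn)
  hi_mul i j h1 h2 h3 := h.hi_mul i j h1 h2 (h3.trans hmn)
  mix_mul i j k h1 h2 h3 h4 := h.mix_mul i j k h1 h2 h3 (h4.trans hmn)

theorem map (h : BSolution n a c cb lo hi mix) (f : L →+* L') :
    BSolution n (f a) (f c) (f cb) (fun i => f (lo i)) (fun i => f (hi i))
      (fun i j => f (mix i j)) where
  lo_mul i j h1 h2 h3 := by simpa using congrArg f (h.lo_mul i j h1 h2 h3)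
  hi_mul i j h1 h2 h3 := by simpa using congrArg f (h.hi_mul i j h1 h2 h3)
  mix_mul i j k h1 h2 h3 h4 := by simpa using congrArg f (h.mix_mul i j k h1 h2 h3 h4)

theorem markingRelations (h : BSolution n a c cb lo hi mix) :
    MarkingRelations (ι := Finset.Icc 4 n) a c cb (fun i => lo i) (fun i => hi i)
      (fun i j => mixAll a lo hi mix i j)
      (lo 4 * hi 4 * (lo 4 + hi 4 + a) - c * hi 4 - cb * lo 4) where
  p_mul := by
    rintro ⟨i, hi'⟩ ⟨j, hj'⟩ hij
    rw [Finset.mem_Icc] at hi' hj'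
    have hij : i ≠ j := fun h => hij (Subtype.ext h)
    simp only [mixAll]
    split_ifs with hlt
    · exact h.lo_mul i j hi'.1 hlt hj'.2
    · linear_combination h.lo_mul j i hj'.1 (by omega) hi'.2
  q_mul := by
    rintro ⟨i, hi'⟩ ⟨j, hj'⟩ hij
    rw [Finset.mem_Icc] at hi' hj'
    have hij : i ≠ j := fun h => hij (Subtype.ext h)
    simp only [mixAll]
    split_ifs with hlt
    · exact h.hi_mul i j hi'.1 hlt hj'.2
    · linear_combination h.hi_mul j i hj'.1 (by omega) hi'.2
  add_swap := by
    rintro ⟨i, hi'⟩ ⟨j, hj'⟩ hij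
    have hij : i ≠ j := fun h => hij (Subtype.ext h)
    simp only [mixAll]
    rcases hij.lt_or_gt with hlt | hlt
    · rw [if_pos hlt, if_neg hlt.not_gt]; ring
    · rw [if_neg hlt.not_gt, if_pos hlt]; ring
  curve := by
    rintro ⟨i, hi'⟩
    rw [Finset.mem_Icc] at hi'
    show lo i * hi i * (lo i + hi i + a) - c * hi i - cb * lo i = _
    obtain rfl | hlt := hi'.1.eq_or_lt
    · rfl
    · linear_combination (hi 4 - hi i) * h.lo_mul 4 i le_rfl hlt hi'.2 -
        (lo i - lo 4) * h.hi_mul 4 i le_rfl hlt hi'.2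

theorem pointRelations (h : BSolution (n + 1) a c cb lo hi mix) :
    PointRelations (ι := Finset.Icc 4 n) a c cb (fun i => lo i) (fun i => hi i)
      (fun i j => mixAll a lo hi mix i j) (lo (n + 1)) (hi (n + 1))
      (fun i => mix i (n + 1)) where
  x_mul := by
    rintro ⟨i, hi'⟩
    rw [Finset.mem_Icc] at hi'
    linear_combination h.lo_mul i (n + 1) hi'.1 (by omega) le_rfl
  y_mul := by
    rintro ⟨i, hi'⟩
    rw [Finset.mem_Icc] at hi'
    linear_combination -h.hi_mul i (n + 1) hi'.1 (by omega) le_rfl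
  z_mul := by
    rintro ⟨i, hi'⟩ ⟨j, hj'⟩ hij
    rw [Finset.mem_Icc] at hi' hj'
    have hij : i ≠ j := fun h => hij (Subtype.ext h)
    simp only [mixAll]
    rcases hij.lt_or_gt with hlt | hlt
    · rw [if_pos hlt, if_neg hlt.not_gt]
      linear_combination -h.mix_mul i j (n + 1) hi'.1 hlt (by omega) le_rfl
    · rw [if_neg hlt.not_gt, if_pos hlt]
      linear_combination -h.mix_mul j i (n + 1) hj'.1 hlt (by omega) le_rfl

theorem extend (h : BSolution n a c cb lo hi mix) {x y : L} {z : ℕ → L}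
    (hpt : PointRelations (ι := Finset.Icc 4 n) a c cb (fun i => lo i) (fun i => hi i)
      (fun i j => mixAll a lo hi mix i j) x y (fun i => z i)) :
    BSolution (n + 1) a c cb (fun i => if i ≤ n then lo i else x)
      (fun i => if i ≤ n then hi i else y) (fun i j => if j ≤ n then mix i j else z i) where
  lo_mul i j h1 h2 h3 := by
    have hi' : i ≤ n := by omega
    by_cases hj : j ≤ n
    · simpa [hi', hj] using h.lo_mul i j h1 h2 hj
    · simp only [hi', hj, if_true, if_false]
      linear_combination hpt.x_mul ⟨i, Finset.mem_Icc.mpr ⟨h1, hi'⟩⟩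
  hi_mul i j h1 h2 h3 := by
    have hi' : i ≤ n := by omega
    by_cases hj : j ≤ n
    · simpa [hi', hj] using h.hi_mul i j h1 h2 hj
    · simp only [hi', hj, if_true, if_false]
      linear_combination -hpt.y_mul ⟨i, Finset.mem_Icc.mpr ⟨h1, hi'⟩⟩
  mix_mul i j k h1 h2 h3 h4 := by
    have hi' : i ≤ n := by omega
    have hj' : j ≤ n := by omega
    by_cases hk : k ≤ n
    · simpa [hi', hj', hk] using h.mix_mul i j k h1 h2 h3 hk
    · have := hpt.z_mul ⟨i, Finset.mem_Icc.mpr ⟨h1, hi'⟩⟩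
        ⟨j, Finset.mem_Icc.mpr ⟨by omega, hj'⟩⟩ (fun h => h2.ne (congrArg Subtype.val h))
      simp only [mixAll, if_pos h2, if_neg h2.not_gt] at this
      simp only [hi', hj', hk, if_true, if_false]
      linear_combination -this

end BSolution

/-- The class of `a` in `B_n(R)`. -/
def gA (n : ℕ) (R : Type*) [CommRing R] : BRing n R := bmk n R (pA n R)

/-- The class of `c` in `B_n(R)`. -/
def gC (n : ℕ) (R : Type*) [CommRing R] : BRing n R := bmk n R (pC n R)

/-- The class of `c̄` in `B_n(R)`. -/
def gCb (n : ℕ) (R : Type*) [CommRing R] : BRing n R := bmk n R (pCb n R)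

/-- The class of `c_i` in `B_n(R)`. -/
def gLo (n : ℕ) (R : Type*) [CommRing R] (i : ℕ) : BRing n R := bmk n R (pLo n R i)

/-- The class of `c̄_i` in `B_n(R)`. -/
def gHi (n : ℕ) (R : Type*) [CommRing R] (i : ℕ) : BRing n R := bmk n R (pHi n R i)

/-- The class of `c_{ij}` in `B_n(R)`. -/
def gMix (n : ℕ) (R : Type*) [CommRing R] (i j : ℕ) : BRing n R := bmk n R (pMix n R i j)

theorem bSolution_generators (n : ℕ) (R : Type*) [CommRing R] :
    BSolution n (gA n R) (gC n R) (gCb n R) (gLo n R) (gHi n R) (gMix n R) := by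
  have key : ∀ p ∈ bRels n R, bmk n R p = 0 := fun p hp =>
    Ideal.Quotient.eq_zero_iff_mem.mpr (Ideal.subset_span hp)
  refine ⟨fun i j h1 h2 h3 => ?_, fun i j h1 h2 h3 => ?_, fun i j k h1 h2 h3 h4 => ?_⟩
  · have := key _ (.inl (.inl ⟨i, j, h1, h2, h3, rfl⟩))
    simp only [map_sub, map_mul, map_add] at this
    exact sub_eq_zero.mp this
  · have := key _ (.inl (.inr ⟨i, j, h1, h2, h3, rfl⟩))
    simp only [map_sub, map_mul, map_add] at this
    exact sub_eq_zero.mp this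
  · have := key _ (.inr ⟨i, j, k, h1, h2, h3, h4, rfl⟩)
    simp only [pMixRev, map_sub, map_mul, map_add] at this
    exact sub_eq_zero.mp this

theorem BSolution.exists_algHom {n : ℕ} {R L : Type*} [CommRing R] [CommRing L] [Algebra R L]
    {a c cb : L} {lo hi : ℕ → L} {mix : ℕ → ℕ → L} (h : BSolution n a c cb lo hi mix) :
    ∃ ψ : BRing n R →ₐ[R] L, ψ (gA n R) = a ∧ ψ (gC n R) = c ∧ ψ (gCb n R) = cb ∧
      (∀ i, 4 ≤ i → i ≤ n → ψ (gLo n R i) = lo i ∧ ψ (gHi n R i) = hi i) ∧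
      ∀ i j, 4 ≤ i → i < j → j ≤ n → ψ (gMix n R i j) = mix i j := by
  let v : BVar n → L := fun s => match s with
    | .A => a
    | .Cc => c
    | .Cb => cb
    | .lo i => lo i
    | .hi i => hi i
    | .mix p => mix p.1.1 p.1.2
  have hA : aeval v (pA n R) = a := by simp [pA, v]
  have hC : aeval v (pC n R) = c := by simp [pC, v]
  have hCb : aeval v (pCb n R) = cb := by simp [pCb, v]
  have hlo : ∀ i, 4 ≤ i → i ≤ n → aeval v (pLo n R i) = lo i := fun i h1 h2 => by
    simp [pLo, v, h1, h2]
  have hhi : ∀ i, 4 ≤ i → i ≤ n → aeval v (pHi n R i) = hi i := fun i h1 h2 => by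
    simp [pHi, v, h1, h2]
  have hmix : ∀ i j, 4 ≤ i → i < j → j ≤ n → aeval v (pMix n R i j) = mix i j :=
    fun i j h1 h2 h3 => by simp [pMix, v, h1, h2, h3]
  have hker : ∀ p ∈ bIdeal n R, aeval v p = 0 := by
    intro p hp
    refine (Ideal.span_le (I := RingHom.ker (aeval v : MvPolynomial (BVar n) R →ₐ[R] L))).mpr
      ?_ hp
    rintro _ ((⟨i, j, h1, h2, h3, rfl⟩ | ⟨i, j, h1, h2, h3, rfl⟩) | ⟨i, j, k, h1, h2, h3, h4, rfl⟩)
    · rw [SetLike.mem_coe, RingHom.mem_ker]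
      simp only [map_sub, map_mul, map_add, hA, hC, hlo i h1 (by omega), hhi i h1 (by omega),
        hlo j (by omega) h3, hhi j (by omega) h3, hmix i j h1 h2 h3]
      exact sub_eq_zero.mpr (h.lo_mul i j h1 h2 h3)
    · rw [SetLike.mem_coe, RingHom.mem_ker]
      simp only [map_sub, map_mul, map_add, hA, hCb, hlo i h1 (by omega), hhi i h1 (by omega),
        hlo j (by omega) h3, hhi j (by omega) h3, hmix i j h1 h2 h3]
      exact sub_eq_zero.mpr (h.hi_mul i j h1 h2 h3)
    · rw [SetLike.mem_coe, RingHom.mem_ker]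
      simp only [pMixRev, map_sub, map_mul, map_add, hA, hC, hlo i h1 (by omega),
        hhi i h1 (by omega), hlo j (by omega) (by omega), hhi j (by omega) (by omega),
        hlo k (by omega) h4, hhi k (by omega) h4, hmix i j h1 h2 (by omega),
        hmix j k (by omega) h3 h4, hmix i k h1 (by omega) h4]
      exact sub_eq_zero.mpr (h.mix_mul i j k h1 h2 h3 h4)
  exact ⟨Ideal.Quotient.liftₐ (bIdeal n R) (aeval v) hker, hA, hC, hCb,
    fun i h1 h2 => ⟨hlo i h1 h2, hhi i h1 h2⟩, hmix⟩

theorem subalgebra_eq_top_of_generators {n : ℕ} {R : Type*} [CommRing R]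
    (S : Subalgebra R (BRing n R)) (hA : gA n R ∈ S) (hC : gC n R ∈ S) (hCb : gCb n R ∈ S)
    (hlo : ∀ i, 4 ≤ i → i ≤ n → gLo n R i ∈ S) (hhi : ∀ i, 4 ≤ i → i ≤ n → gHi n R i ∈ S)
    (hmix : ∀ i j, 4 ≤ i → i < j → j ≤ n → gMix n R i j ∈ S) : S = ⊤ := by
  rw [eq_top_iff]
  rintro w -
  obtain ⟨P, rfl⟩ := Ideal.Quotient.mk_surjective w
  induction P using MvPolynomial.induction_on with
  | C r => exact S.algebraMap_mem r
  | add p q hp hq => rw [map_add]; exact S.add_mem hp hq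
  | mul_X p s hp =>
    rw [map_mul]
    refine S.mul_mem hp ?_
    match s with
    | .A => exact hA
    | .Cc => exact hC
    | .Cb => exact hCb
    | .lo ⟨i, hi⟩ => have := hlo i hi.1 hi.2; rwa [gLo, pLo, dif_pos hi] at this
    | .hi ⟨i, hi⟩ => have := hhi i hi.1 hi.2; rwa [gHi, pHi, dif_pos hi] at this
    | .mix ⟨(i, j), h⟩ =>
      have := hmix i j h.1 h.2.1 h.2.2; rwa [gMix, pMix, dif_pos h] at this

theorem algHom_ext_of_generators {n : ℕ} {R L : Type*} [CommRing R] [CommRing L] [Algebra R L]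
    {f g : BRing n R →ₐ[R] L} (hA : f (gA n R) = g (gA n R)) (hC : f (gC n R) = g (gC n R))
    (hCb : f (gCb n R) = g (gCb n R)) (hlo : ∀ i, 4 ≤ i → i ≤ n → f (gLo n R i) = g (gLo n R i))
    (hhi : ∀ i, 4 ≤ i → i ≤ n → f (gHi n R i) = g (gHi n R i))
    (hmix : ∀ i j, 4 ≤ i → i < j → j ≤ n → f (gMix n R i j) = g (gMix n R i j)) : f = g := by
  have := subalgebra_eq_top_of_generators (AlgHom.equalizer f g) hA hC hCb hlo hhi hmix
  exact AlgHom.ext fun w => (this ▸ Algebra.mem_top : w ∈ AlgHom.equalizer f g)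

instance (n : ℕ) : Finite (BVar n) := by
  let f : BVar n → Fin 6 × Fin (n + 1) × Fin (n + 1) := fun s => match s with
    | .A => (0, 0, 0)
    | .Cc => (1, 0, 0)
    | .Cb => (2, 0, 0)
    | .lo i => (3, ⟨i, by have := i.2; omega⟩, 0)
    | .hi i => (4, ⟨i, by have := i.2; omega⟩, 0)
    | .mix p => (5, ⟨p.1.1, by have := p.2; omega⟩, ⟨p.1.2, by have := p.2; omega⟩)
  refine Finite.of_injective f ?_
  rintro (_ | _ | _ | i | i | p) (_ | _ | _ | j | j | q) h <;>
    simp_all [f, Subtype.ext_iff, Prod.ext_iff]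

end Generators

section Induction

universe u

/-- The properties of `B_n(k)` carried through the induction on `n`: it is a domain of
transcendence degree `n + 1` over which the universal marked curve is generically smooth. -/
structure GenericMarking (n : ℕ) (k : Type u) [Field k] : Prop where
  isDomain : IsDomain (BRing n k)
  gC_ne_zero : gC n k ≠ 0
  gCb_ne_zero : gCb n k ≠ 0
  gC_ne_gCb : gC n k ≠ gCb n k
  gLo_ne : ∀ i j, 4 ≤ i → i < j → j ≤ n → gLo n k i ≠ gLo n k j
  pole_ne_zero : ∀ i, 4 ≤ i → i ≤ n →
    (gA n k + gHi n k i + gLo n k i + gHi n k i) * gLo n k i - gC n k ≠ 0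
  trdeg_eq : Algebra.trdeg k (BRing n k) = (n + 1 : ℕ)

theorem card_bVar_four : Nat.card (BVar 4) = 5 := by
  let f : BVar 4 → Fin 5 := fun s => match s with
    | .A => 0
    | .Cc => 1
    | .Cb => 2
    | .lo _ => 3
    | .hi _ => 4
    | .mix _ => 0
  have hf : Function.Bijective f := by
    constructor
    · rintro (_ | _ | _ | ⟨i, hi⟩ | ⟨i, hi⟩ | ⟨p, hp⟩)
        (_ | _ | _ | ⟨j, hj⟩ | ⟨j, hj⟩ | ⟨q, hq⟩) h <;>
        simp [f] at h ⊢ <;> omega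
    · intro t
      fin_cases t
      exacts [⟨.A, rfl⟩, ⟨.Cc, rfl⟩, ⟨.Cb, rfl⟩, ⟨.lo ⟨4, le_rfl, le_rfl⟩, rfl⟩,
        ⟨.hi ⟨4, le_rfl, le_rfl⟩, rfl⟩]
  rw [Nat.card_eq_of_bijective f hf, Nat.card_eq_fintype_card, Fintype.card_fin]

theorem genericMarking_four (k : Type u) [Field k] : GenericMarking 4 k := by
  have hsol : ∀ c cb : k, BSolution 4 0 c cb (fun _ => 0) (fun _ => 0) (fun _ _ => 0) := fun _ _ =>
    ⟨fun _ _ _ _ _ => by omega, fun _ _ _ _ _ => by omega, fun _ _ _ _ _ _ _ => by omega⟩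
  have hbot : bIdeal 4 k = ⊥ := by
    rw [bIdeal, Ideal.span_eq_bot]
    rintro _ ((⟨i, j, h1, h2, h3, rfl⟩ | ⟨i, j, h1, h2, h3, rfl⟩) | ⟨i, j, k, h1, h2, h3, h4, rfl⟩)
      <;> omega
  have e : BRing 4 k ≃ₐ[k] MvPolynomial (BVar 4) k :=
    (Ideal.quotientEquivAlgOfEq k hbot).trans (AlgEquiv.quotientBot k (MvPolynomial (BVar 4) k))
  obtain ⟨ψ, -, hC, hCb, hlo, -⟩ := (hsol 1 0).exists_algHom (R := k)
  obtain ⟨ψ', -, hC', hCb', -, -⟩ := (hsol 0 1).exists_algHom (R := k)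
  have hC0 : ψ (gC 4 k) ≠ 0 := by rw [hC]; exact one_ne_zero
  refine ⟨e.toMulEquiv.isDomain _, fun h => ?_, fun h => ?_, fun h => ?_,
    fun _ _ _ _ _ => by omega, fun i h1 h2 h => ?_, ?_⟩
  · simp [h] at hC
  · simp [h] at hCb'
  · rw [h, hCb] at hC
    exact zero_ne_one hC
  · have := congrArg ψ h
    rw [map_sub, map_mul, (hlo i h1 h2).1, hC] at this
    simp at this
  · rw [e.trdeg_eq, MvPolynomial.trdeg_of_isDomain]
    rw [← Nat.cast_card, card_bVar_four]
    simp

theorem monomialSpan_eq_top (n : ℕ) (k : Type u) [Field k] [Algebra (BRing n k) (BRing (n + 1) k)]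
    [IsScalarTower k (BRing n k) (BRing (n + 1) k)]
    (hA : algebraMap (BRing n k) (BRing (n + 1) k) (gA n k) = gA (n + 1) k)
    (hC : algebraMap (BRing n k) (BRing (n + 1) k) (gC n k) = gC (n + 1) k)
    (hCb : algebraMap (BRing n k) (BRing (n + 1) k) (gCb n k) = gCb (n + 1) k)
    (hlo : ∀ i, 4 ≤ i → i ≤ n →
      algebraMap (BRing n k) (BRing (n + 1) k) (gLo n k i) = gLo (n + 1) k i)
    (hhi : ∀ i, 4 ≤ i → i ≤ n →
      algebraMap (BRing n k) (BRing (n + 1) k) (gHi n k i) = gHi (n + 1) k i)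
    (hmix : ∀ i j, 4 ≤ i → i < j → j ≤ n →
      algebraMap (BRing n k) (BRing (n + 1) k) (gMix n k i j) = gMix (n + 1) k i j)
    (hmul : ∀ w ∈ monomialSpan (BRing n k) (gLo (n + 1) k (n + 1)) (gHi (n + 1) k (n + 1))
        (fun i : Finset.Icc 4 n => gMix (n + 1) k i (n + 1)),
      gLo (n + 1) k (n + 1) * w ∈ monomialSpan (BRing n k) (gLo (n + 1) k (n + 1))
        (gHi (n + 1) k (n + 1)) (fun i : Finset.Icc 4 n => gMix (n + 1) k i (n + 1)) ∧
      gHi (n + 1) k (n + 1) * w ∈ monomialSpan (BRing n k) (gLo (n + 1) k (n + 1))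
        (gHi (n + 1) k (n + 1)) (fun i : Finset.Icc 4 n => gMix (n + 1) k i (n + 1)) ∧
      ∀ i : Finset.Icc 4 n, gMix (n + 1) k i (n + 1) * w ∈ monomialSpan (BRing n k)
        (gLo (n + 1) k (n + 1)) (gHi (n + 1) k (n + 1))
        (fun i : Finset.Icc 4 n => gMix (n + 1) k i (n + 1))) :
    monomialSpan (BRing n k) (gLo (n + 1) k (n + 1)) (gHi (n + 1) k (n + 1))
        (fun i : Finset.Icc 4 n => gMix (n + 1) k i (n + 1)) = ⊤ := by
  set M := monomialSpan (BRing n k) (gLo (n + 1) k (n + 1)) (gHi (n + 1) k (n + 1))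
    (fun i : Finset.Icc 4 n => gMix (n + 1) k i (n + 1))
  let S : Subalgebra k (BRing (n + 1) k) :=
    { carrier := {v | ∀ w ∈ M, v * w ∈ M}
      mul_mem' := fun {u v} hu hv w hw => by rw [mul_assoc]; exact hu _ (hv w hw)
      add_mem' := fun {u v} hu hv w hw => by rw [add_mul]; exact add_mem (hu w hw) (hv w hw)
      algebraMap_mem' := fun r w hw => by
        rw [IsScalarTower.algebraMap_apply k (BRing n k) (BRing (n + 1) k)]
        exact algebraMap_mul_mem M _ hw }
  have hbase : ∀ r : BRing n k, algebraMap (BRing n k) (BRing (n + 1) k) r ∈ S := fun r w hw =>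
    algebraMap_mul_mem M r hw
  have hS : S = ⊤ := by
    refine subalgebra_eq_top_of_generators S (hA ▸ hbase _) (hC ▸ hbase _) (hCb ▸ hbase _)
      (fun i h1 h2 => ?_) (fun i h1 h2 => ?_) (fun i j h1 h2 h3 => ?_)
    · obtain rfl | hlt := h2.eq_or_lt
      · exact fun w hw => (hmul w hw).1
      · exact hlo i h1 (by omega) ▸ hbase _
    · obtain rfl | hlt := h2.eq_or_lt
      · exact fun w hw => (hmul w hw).2.1
      · exact hhi i h1 (by omega) ▸ hbase _
    · obtain rfl | hlt := h3.eq_or_lt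
      · exact fun w hw => (hmul w hw).2.2 ⟨i, Finset.mem_Icc.mpr ⟨h1, by omega⟩⟩
      · exact hmix i j h1 h2 (by omega) ▸ hbase _
  rw [eq_top_iff]
  rintro v -
  have hv : v ∈ S := hS ▸ Algebra.mem_top
  have h1 : (1 : BRing (n + 1) k) ∈ M := by
    simpa using monomial_mem_monomialSpan (D := BRing n k) (gLo (n + 1) k (n + 1))
      (gHi (n + 1) k (n + 1)) (fun i : Finset.Icc 4 n => gMix (n + 1) k i (n + 1)) 0 0
  simpa using hv 1 h1

theorem GenericMarking.succ {n : ℕ} (hn : 4 ≤ n) {k : Type u} [Field k]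
    (h : GenericMarking n k) : GenericMarking (n + 1) k := by
  have := h.isDomain
  obtain ⟨J, hA, hC, hCb, hlohi, hmix⟩ :=
    ((bSolution_generators (n + 1) k).mono n.le_succ).exists_algHom (R := k)
  have hlo := fun i h1 h2 => (hlohi i h1 h2).1
  have hhi := fun i h1 h2 => (hlohi i h1 h2).2
  let _ : Algebra (BRing n k) (BRing (n + 1) k) := J.toRingHom.toAlgebra
  have hJ : ∀ r, algebraMap (BRing n k) (BRing (n + 1) k) r = J r := fun _ => rfl
  have : IsScalarTower k (BRing n k) (BRing (n + 1) k) :=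
    IsScalarTower.of_algebraMap_eq (R := k) (S := BRing n k) (A := BRing (n + 1) k)
      fun r => (J.commutes r).symm
  have : Nonempty (Finset.Icc 4 n) := ⟨⟨4, Finset.mem_Icc.mpr ⟨le_rfl, hn⟩⟩⟩
  have hmark := (bSolution_generators n k).markingRelations
  have hpt : PointRelations (ι := Finset.Icc 4 n)
      (algebraMap (BRing n k) (BRing (n + 1) k) (gA n k))
      (algebraMap _ (BRing (n + 1) k) (gC n k)) (algebraMap _ (BRing (n + 1) k) (gCb n k))
      (fun i => algebraMap _ (BRing (n + 1) k) (gLo n k i))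
      (fun i => algebraMap _ (BRing (n + 1) k) (gHi n k i))
      (fun i j => algebraMap _ (BRing (n + 1) k)
        (mixAll (gA n k) (gLo n k) (gHi n k) (gMix n k) i j))
      (gLo (n + 1) k (n + 1)) (gHi (n + 1) k (n + 1)) (fun i => gMix (n + 1) k i (n + 1)) := by
    have hlo' : ∀ i : Finset.Icc 4 n, J (gLo n k i) = gLo (n + 1) k i := fun i =>
      hlo i (Finset.mem_Icc.mp i.2).1 (Finset.mem_Icc.mp i.2).2
    have hhi' : ∀ i : Finset.Icc 4 n, J (gHi n k i) = gHi (n + 1) k i := fun i =>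
      hhi i (Finset.mem_Icc.mp i.2).1 (Finset.mem_Icc.mp i.2).2
    have hpt := (bSolution_generators (n + 1) k).pointRelations
    simp only [hJ, hA, hC, hCb, hlo', hhi']
    refine ⟨hpt.x_mul, hpt.y_mul, fun i j hij => ?_⟩
    have hmixAll : ∀ i j : Finset.Icc 4 n, i ≠ j →
        J (mixAll (gA n k) (gLo n k) (gHi n k) (gMix n k) i j) =
        mixAll (gA (n + 1) k) (gLo (n + 1) k) (gHi (n + 1) k) (gMix (n + 1) k) i j := by
      intro i j hij
      have h1 := Finset.mem_Icc.mp i.2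
      have h2 := Finset.mem_Icc.mp j.2
      have hij : (i : ℕ) ≠ j := fun h => hij (Subtype.ext h)
      simp only [mixAll]
      split_ifs with hlt
      · exact hmix i j h1.1 hlt h2.2
      · simp only [map_sub, map_add, hA, hlo', hhi', hmix j i h2.1 (by omega) h1.2]
    simpa only [hmixAll i j hij, hmixAll j i hij.symm] using hpt.z_mul i j hij
  have hspan := monomialSpan_eq_top n k hA hC hCb hlo hhi hmix
    (fun w hw => mul_mem_monomialSpan hpt.x_mul hpt.y_mul hpt.z_mul hw)
  have hp : Function.Injective fun i : Finset.Icc 4 n => gLo n k i := by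
    rintro ⟨i, hi⟩ ⟨j, hj⟩ hij
    rw [Finset.mem_Icc] at hi hj
    by_contra hne
    have hne : i ≠ j := fun h => hne (Subtype.ext h)
    rcases hne.lt_or_gt with hlt | hlt
    · exact h.gLo_ne i j hi.1 hlt hj.2 hij
    · exact h.gLo_ne j i hj.1 hlt hi.2 hij.symm
  obtain ⟨hdom, hindep⟩ := isDomain_and_normalForm_unique_of_universal hmark h.gC_ne_zero h.gCb_ne_zero
    h.gC_ne_gCb hp
    (fun i => h.pole_ne_zero i (Finset.mem_Icc.mp i.2).1 (Finset.mem_Icc.mp i.2).2) hpt hspan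
    (by
      intro L _ J' x' y' z' hz'
      let _ : Algebra k L := (J'.comp (algebraMap k (BRing n k))).toAlgebra
      obtain ⟨zz, hzz⟩ : ∃ zz : ℕ → L, (fun i : Finset.Icc 4 n => zz i) = z' :=
        ⟨fun i => if h : i ∈ Finset.Icc 4 n then z' ⟨i, h⟩ else 0, by
          funext i
          simp only [i.2, dif_pos]⟩
      simp only [map_mixAll] at hz'
      rw [← hzz] at hz'
      obtain ⟨ψ, pA, pC, pCb, plohi, pmix⟩ :=
        (((bSolution_generators n k).map J').extend hz').exists_algHom (R := k)
      let J'' : BRing n k →ₐ[k] L := { J' with commutes' := fun r => rfl }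
      have hcomp : ψ.comp J = J'' := by
        refine algHom_ext_of_generators ?_ ?_ ?_ (fun i h1 h2 => ?_) (fun i h1 h2 => ?_)
          (fun i j h1 h2 h3 => ?_)
        · rw [AlgHom.comp_apply, hA, pA]; rfl
        · rw [AlgHom.comp_apply, hC, pC]; rfl
        · rw [AlgHom.comp_apply, hCb, pCb]; rfl
        · rw [AlgHom.comp_apply, hlo i h1 h2, (plohi i h1 (by omega)).1, if_pos h2]; rfl
        · rw [AlgHom.comp_apply, hhi i h1 h2, (plohi i h1 (by omega)).2, if_pos h2]; rfl
        · rw [AlgHom.comp_apply, hmix i j h1 h2 h3, pmix i j h1 h2 (by omega), if_pos h3]; rfl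
      refine ⟨ψ.toRingHom, RingHom.ext fun r => DFunLike.congr_fun hcomp r, ?_, ?_, fun i => ?_⟩
      · exact (plohi (n + 1) (by omega) le_rfl).1.trans (if_neg (by omega))
      · exact (plohi (n + 1) (by omega) le_rfl).2.trans (if_neg (by omega))
      · have hi := Finset.mem_Icc.mp i.2
        refine (pmix i (n + 1) hi.1 (by omega) le_rfl).trans ((if_neg (by omega)).trans ?_)
        exact congrFun hzz i)
  have hx : Transcendental (BRing n k) (gLo (n + 1) k (n + 1)) := by
    rw [transcendental_iff]
    exact fun f hf => (hindep f 0 (by simp [hf])).1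
  have hinj : Function.Injective J := by
    rw [injective_iff_map_eq_zero]
    intro r hr
    have := (hindep (Polynomial.C r) 0 (by
      rw [Polynomial.aeval_C, hJ, hr, map_zero, mul_zero, add_zero])).1
    exact Polynomial.C_eq_zero.mp this
  refine ⟨hdom, ?_, ?_, ?_, fun i j h1 h2 h3 => ?_, fun i h1 h2 => ?_, ?_⟩
  · rw [← hC]; exact (map_ne_zero_iff J hinj).mpr h.gC_ne_zero
  · rw [← hCb]; exact (map_ne_zero_iff J hinj).mpr h.gCb_ne_zero
  · rw [← hC, ← hCb]; exact hinj.ne h.gC_ne_gCb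
  · obtain rfl | hlt := h3.eq_or_lt
    · intro hij
      rw [← hij, ← hlo i h1 (by omega)] at hx
      exact hx (isAlgebraic_algebraMap _)
    · rw [← hlo i h1 (by omega), ← hlo j (by omega) (by omega)]
      exact hinj.ne (h.gLo_ne i j h1 h2 (by omega))
  · obtain rfl | hlt := h2.eq_or_lt
    · intro h0
      have h0' := (hindep (Polynomial.X ^ 2 + Polynomial.C (gA n k) * Polynomial.X -
        Polynomial.C (gC n k)) (2 * Polynomial.X) (by
          simp only [map_add, map_sub, map_mul, map_pow, Polynomial.aeval_X, Polynomial.aeval_C,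
            hJ, hA, hC, map_ofNat]
          linear_combination h0)).1
      exact h.gC_ne_zero (by simpa using congrArg (Polynomial.eval 0) h0')
    · rw [← hC, ← hA, ← hlo i h1 (by omega), ← hhi i h1 (by omega)]
      simpa only [map_sub, map_mul, map_add] using
        (map_ne_zero_iff J hinj).mpr (h.pole_ne_zero i h1 (by omega))
  · have : FaithfulSMul (BRing n k) (BRing (n + 1) k) :=
      (faithfulSMul_iff_algebraMap_injective _ _).mpr hinj
    rw [← trdeg_add_eq k (BRing n k) (A := BRing (n + 1) k), h.trdeg_eq,
      trdeg_eq_one_of_pointRelations hmark hpt hspan hx]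
    simp

theorem genericMarking {n : ℕ} (hn : 4 ≤ n) (k : Type u) [Field k] : GenericMarking n k := by
  induction n, hn using Nat.le_induction with
  | base => exact genericMarking_four k
  | succ n hn ih => exact ih.succ hn

end Induction

/-- part of Theorem 1.10: for `n ≥ 6` and any field `k`, `Spec B_n(k)` is
irreducible (equivalently, the nilradical of `B_n(k)` is prime) and the Krull dimension of
`B_n(k)` is `n + 1`; i.e. `M̄_{1,n}^∞ × Spec(k)` is an irreducible projective variety of
dimension `n`. -/
theorem stmt5 (n : ℕ) (hn : 6 ≤ n) (k : Type*) [Field k] :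
    (nilradical (BRing n k)).IsPrime ∧ ringKrullDim (BRing n k) = (n + 1 : ℕ) := by
  have h := genericMarking (by omega : 4 ≤ n) k
  have := h.isDomain
  refine ⟨?_, ringKrullDim_eq_of_trdeg_eq h.trdeg_eq⟩
  rw [nilradical_eq_zero]
  exact Ideal.isPrime_bot
end
end

section
/- Let k be a field and n ≥ 3. Let A be the quotient of the polynomial ring k[x_2, …, x_n] by the ideal generated by x_i·x_j − x_2·x_3 for all 2 ≤ i < j ≤ n with (i,j) ≠ (2,3), together with x_2·x_3² − x_2²·x_3. Let φ : A → ∏_{i=1}^n k[t] (the product of n copies of the polynomial ring in one variable) be the k-algebra homomorphism determined by sending x_j (for 2 ≤ j ≤ n) to the tuple whose 1st component is t, whose j-th component is t, and whose remaining components are 0. Then φ is well defined and injective, and its image is exactly the set of tuples (f_1, …, f_n) such that f_i(0) = f_j(0) for all i, j, and f_1′(0) = f_2′(0) + f_3′(0) + … + f_n′(0), where f′ denotes the formal derivative of a polynomial. -/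
noncomputable section

open MvPolynomial

/-- Variables `x_i` for `2 ≤ i ≤ n`. -/
abbrev NFVar (n : ℕ) := {i : ℕ // 2 ≤ i ∧ i ≤ n}

/-- The polynomial `x_i` (junk value `0` if `i` is out of range). -/
def xP (n : ℕ) (k : Type*) [Field k] (i : ℕ) : MvPolynomial (NFVar n) k :=
  if h : 2 ≤ i ∧ i ≤ n then X (⟨i, h⟩ : NFVar n) else 0

/-- The defining relations of the affine part of the elliptic `n`-fold curve:
`x_i x_j = x_2 x_3` for `2 ≤ i < j ≤ n`, `(i,j) ≠ (2,3)`, and `x_2 x_3² = x_2² x_3`. -/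
def enRels (n : ℕ) (k : Type*) [Field k] : Set (MvPolynomial (NFVar n) k) :=
  {p | ∃ i j : ℕ, 2 ≤ i ∧ i < j ∧ j ≤ n ∧ (i, j) ≠ (2, 3) ∧
      p = xP n k i * xP n k j - xP n k 2 * xP n k 3} ∪
  {xP n k 2 * xP n k 3 ^ 2 - xP n k 2 ^ 2 * xP n k 3}

/-- The ring of functions on `C_{1,n} \ {p_1, …, p_n}`. -/
abbrev EnAlg (n : ℕ) (k : Type*) [Field k] :=
  MvPolynomial (NFVar n) k ⧸ Ideal.span (enRels n k)

/-- The image of the variable `x_j`: the tuple whose components no. `1` and no. `j`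
(0-indexed: `0` and `j−1`) equal `t`, all other components being `0`. -/
def enTarget (n : ℕ) (k : Type*) [Field k] (j : NFVar n) : Fin n → Polynomial k :=
  fun i => if i.1 = 0 ∨ i.1 + 1 = j.1 then Polynomial.X else 0

/-- The map on the polynomial ring determined by `x_j ↦ enTarget j`. -/
def enPsi (n : ℕ) (k : Type*) [Field k] :
    MvPolynomial (NFVar n) k →ₐ[k] (Fin n → Polynomial k) :=
  aeval (enTarget n k)

/-- The polynomial `c + ∑ j, x_j p_j(x_j) + x_a x_b q(x_a)`. -/
def branchForm {ι k : Type*} [Fintype ι] [Field k] (a b : ι) (c : k) (p : ι → Polynomial k)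
    (q : Polynomial k) : MvPolynomial ι k :=
  C c + ∑ j, X j * Polynomial.aeval (X j) (p j) + X a * X b * Polynomial.aeval (X a) q

theorem aeval_branchForm {ι k B : Type*} [Fintype ι] [Field k] [CommRing B] [Algebra k B]
    (x : ι → B) (a b : ι) (c : k) (p : ι → Polynomial k) (q : Polynomial k) :
    aeval x (branchForm a b c p q) =
      algebraMap k B c + ∑ j, x j * Polynomial.aeval (x j) (p j) +
        x a * x b * Polynomial.aeval (x a) q := by
  simp [branchForm, ← Polynomial.aeval_algHom_apply]

theorem mul_aeval_eq_of_mul_eq {k B : Type*} [Field k] [CommRing B] [Algebra k B]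
    {u y z : B} (h : u * y = u * z) (p : Polynomial k) :
    u * Polynomial.aeval y p = u * Polynomial.aeval z p := by
  obtain ⟨r, hr⟩ := Polynomial.sub_dvd_eval_sub y z (p.map (algebraMap k B))
  simp only [Polynomial.eval_map_algebraMap] at hr
  rw [← sub_eq_zero, ← mul_sub, hr, ← mul_assoc, mul_sub, h, sub_self, zero_mul]

theorem exists_aeval_eq_aeval_branchForm {ι k B : Type*} [Fintype ι] [Field k] [CommRing B]
    [Algebra k B] (x : ι → B) (a b : ι) (hne : ∀ i j, i ≠ j → x i * x j = x a * x b)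
    (hmul : ∀ i, x a * x b * x i = x a * x b * x a) (P : MvPolynomial ι k) :
    ∃ (c : k) (p : ι → Polynomial k) (q : Polynomial k),
      aeval x P = aeval x (branchForm a b c p q) := by
  classical
  simp only [aeval_branchForm]
  induction P using MvPolynomial.induction_on with
  | C c => exact ⟨c, 0, 0, by simp⟩
  | add P Q hP hQ =>
    obtain ⟨c, p, q, h⟩ := hP
    obtain ⟨c', p', q', h'⟩ := hQ
    refine ⟨c + c', p + p', q + q', ?_⟩
    simp only [map_add, h, h', Pi.add_apply, mul_add, Finset.sum_add_distrib]
    ring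
  | mul_X P i hP =>
    obtain ⟨c, p, q, h⟩ := hP
    refine ⟨0, Pi.single i (Polynomial.C c + Polynomial.X * p i),
      ∑ j ∈ Finset.univ.erase i, p j + Polynomial.X * q, ?_⟩
    have hsum : (∑ j ∈ Finset.univ.erase i, x j * Polynomial.aeval (x j) (p j)) * x i =
        x a * x b * Polynomial.aeval (x a) (∑ j ∈ Finset.univ.erase i, p j) := by
      rw [map_sum, Finset.mul_sum, Finset.sum_mul]
      refine Finset.sum_congr rfl fun j hj => ?_
      rw [mul_right_comm, hne j i (Finset.ne_of_mem_erase hj), mul_aeval_eq_of_mul_eq (hmul j)]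
    have hsingle : ∑ j, x j * Polynomial.aeval (x j)
        ((Pi.single i (Polynomial.C c + Polynomial.X * p i) : ι → Polynomial k) j) =
        x i * Polynomial.aeval (x i) (Polynomial.C c + Polynomial.X * p i) := by
      rw [Finset.sum_eq_single i (fun j _ hj => by simp [Pi.single_eq_of_ne hj]) (by simp),
        Pi.single_eq_same]
    rw [map_mul, aeval_X, h, hsingle, ← Finset.add_sum_erase _ _ (Finset.mem_univ i), map_add,
      map_add, mul_add (x a * x b), ← hsum]
    simp only [map_mul, Polynomial.aeval_X, Polynomial.aeval_C, map_zero]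
    linear_combination Polynomial.aeval (x a) q * hmul i

theorem enPsi_apply (n : ℕ) (k : Type*) [Field k] (P : MvPolynomial (NFVar n) k) (i : Fin n) :
    enPsi n k P i = aeval (fun j => enTarget n k j i) P :=
  DFunLike.congr_fun (MvPolynomial.comp_aeval (enTarget n k)
    (Pi.evalAlgHom k (fun _ : Fin n => Polynomial k) i)) P

theorem enTarget_mul_enTarget_of_ne {n : ℕ} (k : Type*) [Field k] {i j : NFVar n} (h : i ≠ j) :
    enTarget n k i * enTarget n k j =
      fun m => if m.1 = 0 then Polynomial.X * Polynomial.X else 0 := by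
  funext m
  have h' : i.1 ≠ j.1 := fun e => h (Subtype.ext e)
  simp only [Pi.mul_apply, enTarget]
  split_ifs <;> first | omega | simp

theorem enPsi_eq_zero_of_mem_enRels {n : ℕ} (hn : 3 ≤ n) {k : Type*} [Field k]
    {P : MvPolynomial (NFVar n) k} (hP : P ∈ enRels n k) : enPsi n k P = 0 := by
  have h2 : 2 ≤ 2 ∧ 2 ≤ n := by omega
  have h3 : 2 ≤ 3 ∧ 3 ≤ n := by omega
  have h23 : (⟨2, h2⟩ : NFVar n) ≠ ⟨3, h3⟩ := by simp
  rcases hP with ⟨i, j, hi, hij, hj, -, rfl⟩ | rfl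
  · have hi' : 2 ≤ i ∧ i ≤ n := by omega
    have hj' : 2 ≤ j ∧ j ≤ n := by omega
    have hne : (⟨i, hi'⟩ : NFVar n) ≠ ⟨j, hj'⟩ := by simpa using hij.ne
    simp only [xP, dif_pos h2, dif_pos h3, dif_pos hi', dif_pos hj', enPsi, map_sub, map_mul,
      aeval_X, enTarget_mul_enTarget_of_ne k hne, enTarget_mul_enTarget_of_ne k h23, sub_self]
  · have key : enTarget n k ⟨2, h2⟩ * enTarget n k ⟨3, h3⟩ *
        (enTarget n k ⟨3, h3⟩ - enTarget n k ⟨2, h2⟩) = 0 := by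
      rw [enTarget_mul_enTarget_of_ne k h23]
      funext m
      by_cases hm : m.1 = 0 <;> simp [enTarget, hm]
    simp only [xP, dif_pos h2, dif_pos h3, enPsi, map_sub, map_mul, map_pow, aeval_X]
    linear_combination key

theorem mk_X_mul_mk_X_of_ne {n : ℕ} (hn : 3 ≤ n) (k : Type*) [Field k] {i j : NFVar n}
    (h : i ≠ j) :
    (Ideal.Quotient.mk (Ideal.span (enRels n k)) (X i) * Ideal.Quotient.mk _ (X j) : EnAlg n k) =
      Ideal.Quotient.mk _ (X ⟨2, by omega⟩) * Ideal.Quotient.mk _ (X ⟨3, by omega⟩) := by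
  wlog hij : i.1 < j.1 generalizing i j
  · rw [mul_comm]
    exact this h.symm (lt_of_le_of_ne (not_lt.mp hij) fun e => h (Subtype.ext e.symm))
  by_cases h23 : (i.1, j.1) = (2, 3)
  · obtain ⟨i, hi⟩ := i
    obtain ⟨j, hj⟩ := j
    simp only [Prod.mk.injEq] at h23
    obtain ⟨rfl, rfl⟩ := h23
    rfl
  · rw [← map_mul, ← map_mul, Ideal.Quotient.eq]
    refine Ideal.subset_span (Or.inl ⟨i, j, i.2.1, hij, j.2.2, h23, ?_⟩)
    simp only [xP, dif_pos i.2, dif_pos j.2, dif_pos (show 2 ≤ 2 ∧ 2 ≤ n by omega),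
      dif_pos (show 2 ≤ 3 ∧ 3 ≤ n by omega)]

theorem mk_X_two_mul_mk_X_three_mul_mk_X {n : ℕ} (hn : 3 ≤ n) (k : Type*) [Field k]
    (i : NFVar n) :
    (Ideal.Quotient.mk (Ideal.span (enRels n k)) (X ⟨2, by omega⟩) *
      Ideal.Quotient.mk _ (X ⟨3, by omega⟩) * Ideal.Quotient.mk _ (X i) : EnAlg n k) =
      Ideal.Quotient.mk _ (X ⟨2, by omega⟩) * Ideal.Quotient.mk _ (X ⟨3, by omega⟩) *
        Ideal.Quotient.mk _ (X ⟨2, by omega⟩) := by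
  have h2 : 2 ≤ 2 ∧ 2 ≤ n := by omega
  have h3 : 2 ≤ 3 ∧ 3 ≤ n := by omega
  by_cases hi : i = ⟨3, h3⟩
  · subst hi
    simp only [← map_mul]
    rw [Ideal.Quotient.eq]
    refine Ideal.subset_span (Or.inr ?_)
    simp only [xP, dif_pos h2, dif_pos h3, Set.mem_singleton_iff]
    ring
  · linear_combination Ideal.Quotient.mk (Ideal.span (enRels n k)) (X ⟨2, h2⟩) *
      mk_X_mul_mk_X_of_ne hn k hi

instance (n : ℕ) : Fintype (NFVar n) :=
  Fintype.subtype (Finset.Icc 2 n) fun _ => Finset.mem_Icc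

theorem enPsi_branchForm_zero {n : ℕ} (h0 : 0 < n) {k : Type*} [Field k] (a b : NFVar n) (c : k)
    (p : NFVar n → Polynomial k) (q : Polynomial k) :
    enPsi n k (branchForm a b c p q) ⟨0, h0⟩ =
      Polynomial.C c + ∑ j, Polynomial.X * p j + Polynomial.X * Polynomial.X * q := by
  rw [enPsi_apply, aeval_branchForm]
  simp [enTarget, Polynomial.algebraMap_eq]

theorem enPsi_branchForm_pred {n : ℕ} {k : Type*} [Field k] {a b : NFVar n} (hab : a ≠ b) (c : k)
    (p : NFVar n → Polynomial k) (q : Polynomial k) (j : NFVar n) (i : Fin n)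
    (hi : i.1 + 1 = j.1) :
    enPsi n k (branchForm a b c p q) i = Polynomial.C c + Polynomial.X * p j := by
  have hj := j.2.1
  have hi0 : i.1 ≠ 0 := by omega
  have hu : enTarget n k a i * enTarget n k b i = 0 := by
    simpa [hi0] using congrFun (enTarget_mul_enTarget_of_ne k hab) i
  rw [enPsi_apply, aeval_branchForm, hu, zero_mul, add_zero, Finset.sum_eq_single j]
  · simp [enTarget, hi, Polynomial.algebraMap_eq]
  · intro m _ hm
    have : i.1 + 1 ≠ m.1 := fun e => hm (Subtype.ext (e.symm.trans hi))
    simp [enTarget, hi0, this]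
  · simp

theorem sum_erase_zero_eq_sum_NFVar {n : ℕ} (h0 : 0 < n) {M : Type*} [AddCommMonoid M]
    (g : Fin n → M) :
    ∑ i ∈ Finset.univ.erase (⟨0, h0⟩ : Fin n), g i =
      ∑ j : NFVar n, g ⟨j.1 - 1, by have := j.2; omega⟩ := by
  symm
  refine Finset.sum_bij (fun j _ => ⟨j.1 - 1, by have := j.2; omega⟩) ?_ ?_ ?_ fun _ _ => rfl
  · intro j _
    have := j.2
    simp only [Finset.mem_erase, Finset.mem_univ, and_true, ne_eq, Fin.mk.injEq]
    omega
  · intro i _ j _ h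
    have hi := i.2
    have hj := j.2
    simp only [Fin.mk.injEq] at h
    exact Subtype.ext (by omega)
  · intro i hi
    simp only [Finset.mem_erase, Finset.mem_univ, and_true, ne_eq, Fin.ext_iff] at hi
    exact ⟨⟨i.1 + 1, by omega, by omega⟩, Finset.mem_univ _, rfl⟩

theorem branchForm_eq_zero_of_enPsi_eq_zero {n : ℕ} {k : Type*} [Field k] {a b : NFVar n}
    (hab : a ≠ b) {c : k} {p : NFVar n → Polynomial k} {q : Polynomial k}
    (h : enPsi n k (branchForm a b c p q) = 0) : branchForm a b c p q = 0 := by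
  have h0 : 0 < n := by have := a.2; omega
  have hj (j : NFVar n) : Polynomial.C c + Polynomial.X * p j = 0 := by
    have := j.2
    rw [← enPsi_branchForm_pred hab c p q j ⟨j.1 - 1, by omega⟩ (by simp only; omega), h]
    rfl
  have hc : c = 0 := by simpa using congrArg (Polynomial.eval 0) (hj a)
  subst hc
  have hp : p = 0 := by
    funext j
    simpa using hj j
  subst hp
  have hq : q = 0 := by simpa [h] using enPsi_branchForm_zero h0 a b 0 0 q
  simp [branchForm, hq]

theorem range_enPsi_branchForm {n : ℕ} (h0 : 0 < n) {k : Type*} [Field k] {a b : NFVar n}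
    (hab : a ≠ b) (f : Fin n → Polynomial k) :
    (∃ c p q, enPsi n k (branchForm a b c p q) = f) ↔
      (∀ i j : Fin n, (f i).eval 0 = (f j).eval 0) ∧
        (Polynomial.derivative (f ⟨0, h0⟩)).eval 0 =
          ∑ i ∈ Finset.univ.erase (⟨0, h0⟩ : Fin n), (Polynomial.derivative (f i)).eval 0 := by
  rw [sum_erase_zero_eq_sum_NFVar]
  constructor
  · rintro ⟨c, p, q, rfl⟩
    have hpred (j : NFVar n) := enPsi_branchForm_pred hab c p q j
      ⟨j.1 - 1, by have := j.2; omega⟩ (by have := j.2; simp only; omega)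
    refine ⟨?_, ?_⟩
    · suffices ∀ i, (enPsi n k (branchForm a b c p q) i).eval 0 = c from
        fun i j => (this i).trans (this j).symm
      intro i
      by_cases hi : i.1 = 0
      · obtain rfl : i = ⟨0, h0⟩ := Fin.ext hi
        simp [enPsi_branchForm_zero, Polynomial.eval_finsetSum]
      · simp [enPsi_branchForm_pred hab c p q ⟨i.1 + 1, by omega, by omega⟩ i rfl]
    · simp [hpred, enPsi_branchForm_zero, Polynomial.eval_finsetSum]
  · rintro ⟨hval, hder⟩
    set c := (f ⟨0, h0⟩).eval 0 with hc
    have hdvd (g : Polynomial k) (hg : g.eval 0 = c) :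
        g = Polynomial.C c + Polynomial.X * g.divX := by
      rw [← hg, ← Polynomial.coeff_zero_eq_eval_zero, add_comm, Polynomial.X_mul_divX_add]
    let p : NFVar n → Polynomial k := fun j => (f ⟨j.1 - 1, by have := j.2; omega⟩).divX
    have hp (j : NFVar n) : f ⟨j.1 - 1, by have := j.2; omega⟩ =
        Polynomial.C c + Polynomial.X * p j := hdvd _ (hval _ _)
    have hf0 := hdvd (f ⟨0, h0⟩) rfl
    have hr : ((f ⟨0, h0⟩).divX - ∑ j, p j).eval 0 = 0 := by
      rw [hf0] at hder
      simp only [hp] at hder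
      simpa [Polynomial.eval_finsetSum, sub_eq_zero] using hder
    obtain ⟨q, hq⟩ := Polynomial.X_dvd_iff.mpr
      ((Polynomial.coeff_zero_eq_eval_zero _).trans hr)
    refine ⟨c, p, q, funext fun i => ?_⟩
    by_cases hi : i.1 = 0
    · obtain rfl : i = ⟨0, h0⟩ := Fin.ext hi
      rw [enPsi_branchForm_zero, hf0, ← Finset.mul_sum]
      linear_combination -Polynomial.X * hq
    · rw [enPsi_branchForm_pred hab c p q ⟨i.1 + 1, by omega, by omega⟩ i rfl]
      exact (hp ⟨i.1 + 1, by omega, by omega⟩).symm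

/-- Lemma 2.3(i), `n ≥ 3`: the map `φ : A → ∏_{i=1}^n k[t]` sending `x_j` to
the tuple with `t` in components `1` and `j` and `0` elsewhere is well defined and injective,
with image the set of tuples `(f_1, …, f_n)` with all `f_i(0)` equal and
`f_1′(0) = f_2′(0) + ⋯ + f_n′(0)`. -/
theorem stmt9 (n : ℕ) (hn : 3 ≤ n) (k : Type*) [Field k] :
    ∃ φ : EnAlg n k →ₐ[k] (Fin n → Polynomial k),
      (∀ p : MvPolynomial (NFVar n) k,
        φ (Ideal.Quotient.mk (Ideal.span (enRels n k)) p) = enPsi n k p) ∧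
      Function.Injective φ ∧
      Set.range φ = {f : Fin n → Polynomial k |
        (∀ i j : Fin n, (f i).eval 0 = (f j).eval 0) ∧
        (Polynomial.derivative (f ⟨0, by omega⟩)).eval 0 =
          ∑ i ∈ Finset.univ.erase (⟨0, by omega⟩ : Fin n),
            (Polynomial.derivative (f i)).eval 0} := by
  have hvan : ∀ P ∈ Ideal.span (enRels n k), enPsi n k P = 0 := fun P hP =>
    (Ideal.span_le (I := RingHom.ker (enPsi n k))).mpr
      (fun _ h => enPsi_eq_zero_of_mem_enRels hn h) hP
  let a : NFVar n := ⟨2, by omega⟩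
  let b : NFVar n := ⟨3, by omega⟩
  have hab : a ≠ b := by simp [a, b]
  have hform (P : MvPolynomial (NFVar n) k) : ∃ c p q,
      Ideal.Quotient.mk (Ideal.span (enRels n k)) P =
        Ideal.Quotient.mk _ (branchForm a b c p q) := by
    have haeval (Q : MvPolynomial (NFVar n) k) :
        aeval (fun i => Ideal.Quotient.mk (Ideal.span (enRels n k)) (X i)) Q =
          Ideal.Quotient.mk (Ideal.span (enRels n k)) Q :=
      (DFunLike.congr_fun
        (MvPolynomial.aeval_unique (Ideal.Quotient.mkₐ k (Ideal.span (enRels n k)))) Q).symm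
    simpa only [haeval] using exists_aeval_eq_aeval_branchForm
      (fun i => Ideal.Quotient.mk (Ideal.span (enRels n k)) (X i)) a b
      (fun _ _ h => mk_X_mul_mk_X_of_ne hn k h) (mk_X_two_mul_mk_X_three_mul_mk_X hn k) P
  refine ⟨Ideal.Quotient.liftₐ _ (enPsi n k) hvan, fun _ => rfl, ?_, ?_⟩
  · rw [injective_iff_map_eq_zero]
    intro y hy
    obtain ⟨P, rfl⟩ := Ideal.Quotient.mk_surjective y
    obtain ⟨c, p, q, h⟩ := hform P
    rw [h] at hy ⊢
    rw [branchForm_eq_zero_of_enPsi_eq_zero hab hy, map_zero]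
  · ext f
    rw [Set.mem_ofPred_eq, ← range_enPsi_branchForm (by omega) hab f]
    constructor
    · rintro ⟨y, rfl⟩
      obtain ⟨P, rfl⟩ := Ideal.Quotient.mk_surjective y
      obtain ⟨c, p, q, h⟩ := hform P
      exact ⟨c, p, q, by rw [h]; rfl⟩
    · rintro ⟨c, p, q, rfl⟩
      exact ⟨Ideal.Quotient.mk _ (branchForm a b c p q), rfl⟩
end
end

section
/- Let k be a field with char(k) ≠ 2 and let A = k[x, y]/(y² − y·x²). Let φ : A → k[t] × k[s] be the k-algebra homomorphism determined by x ↦ (t, s) and y ↦ (t², 0). Then φ is well defined and injective, and its image is exactly the set of pairs (f, g) with f(0) = g(0) and f′(0) = g′(0), where f′ denotes the formal derivative of a polynomial. -/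
noncomputable section

open MvPolynomial

/-- The tacnode relation `y² − y x²`, with `x = X 0`, `y = X 1`. -/
def tnRel (k : Type*) [Field k] : MvPolynomial (Fin 2) k := X 1 ^ 2 - X 1 * X 0 ^ 2

/-- The affine coordinate ring `A = k[x,y]/(y² − y x²)` of the tacnode. -/
abbrev TnAlg (k : Type*) [Field k] := MvPolynomial (Fin 2) k ⧸ Ideal.span {tnRel k}

/-- The map on the polynomial ring determined by `x ↦ (t, s)`, `y ↦ (t², 0)`. -/
def tnPsi (k : Type*) [Field k] :
    MvPolynomial (Fin 2) k →ₐ[k] Polynomial k × Polynomial k :=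
  aeval ![(Polynomial.X, Polynomial.X), (Polynomial.X ^ 2, 0)]

/-- The value of `tnPsi` on `a(x) + y b(x)`. -/
theorem tnPsi_add_mul (k : Type*) [Field k] (a b : Polynomial k) :
    tnPsi k (Polynomial.aeval (X 0) a + X 1 * Polynomial.aeval (X 0) b) =
      (a + Polynomial.X ^ 2 * b, a) := by
  have h (c : Polynomial k) : tnPsi k (Polynomial.aeval (X 0) c) = (c, c) := by
    rw [← Polynomial.aeval_algHom_apply]
    simp [tnPsi, Polynomial.aeval_prod_apply]
  rw [map_add, map_mul, h, h]
  simp [tnPsi]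

theorem tnPsi_tnRel (k : Type*) [Field k] : tnPsi k (tnRel k) = 0 := by
  simp only [tnPsi, tnRel, map_sub, map_pow, map_mul, aeval_X]
  ext1 <;> simp; ring

/-- Modulo the tacnode relation every polynomial has the form `a(x) + y b(x)`. -/
theorem exists_tnRel_dvd_sub (k : Type*) [Field k] (p : MvPolynomial (Fin 2) k) :
    ∃ a b : Polynomial k,
      tnRel k ∣ p - (Polynomial.aeval (X 0) a + X 1 * Polynomial.aeval (X 0) b) := by
  induction p using MvPolynomial.induction_on with
  | C c => exact ⟨Polynomial.C c, 0, by simp [algebraMap_eq]⟩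
  | add p q hp hq =>
    obtain ⟨a, b, u, hu⟩ := hp
    obtain ⟨a', b', v, hv⟩ := hq
    refine ⟨a + a', b + b', u + v, ?_⟩
    rw [map_add, map_add]
    linear_combination hu + hv
  | mul_X p i hp =>
    obtain ⟨a, b, u, hu⟩ := hp
    fin_cases i
    · refine ⟨a * Polynomial.X, b * Polynomial.X, u * X 0, ?_⟩
      simp only [Fin.zero_eta, map_mul, Polynomial.aeval_X]
      linear_combination X 0 * hu
    · refine ⟨0, a + Polynomial.X ^ 2 * b, u * X 1 + Polynomial.aeval (X 0) b, ?_⟩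
      simp only [Fin.mk_one, map_zero, map_add, map_mul, map_pow, Polynomial.aeval_X]
      rw [tnRel] at hu ⊢
      linear_combination X 1 * hu

/-- Two polynomials agree to first order at `0` iff they are congruent modulo `X ^ 2`. -/
theorem X_sq_dvd_sub_iff {k : Type*} [Field k] (f g : Polynomial k) :
    Polynomial.X ^ 2 ∣ f - g ↔ f.eval 0 = g.eval 0 ∧
      (Polynomial.derivative f).eval 0 = (Polynomial.derivative g).eval 0 := by
  simp [Polynomial.X_pow_dvd_iff, Nat.le_one_iff_eq_zero_or_eq_one, ← Polynomial.coeff_zero_eq_eval_zero,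
    Polynomial.coeff_derivative, sub_eq_zero]

/-- Lemma 2.3(i), `n = 2`: for `char(k) ≠ 2`, the map
`φ : k[x,y]/(y² − y x²) → k[t] × k[s]`, `x ↦ (t,s)`, `y ↦ (t²,0)`, is well defined and
injective, with image the pairs `(f, g)` with `f(0) = g(0)` and `f′(0) = g′(0)`. -/
theorem stmt10 (k : Type*) [Field k] (hchar : ringChar k ≠ 2) :
    ∃ φ : TnAlg k →ₐ[k] Polynomial k × Polynomial k,
      (∀ p : MvPolynomial (Fin 2) k,
        φ (Ideal.Quotient.mk (Ideal.span {tnRel k}) p) = tnPsi k p) ∧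
      Function.Injective φ ∧
      Set.range φ = {fg : Polynomial k × Polynomial k |
        fg.1.eval 0 = fg.2.eval 0 ∧
        (Polynomial.derivative fg.1).eval 0 = (Polynomial.derivative fg.2).eval 0} := by
  have hker : ∀ p ∈ Ideal.span {tnRel k}, tnPsi k p = 0 := by
    intro p hp
    obtain ⟨q, rfl⟩ := Ideal.mem_span_singleton.mp hp
    rw [map_mul, tnPsi_tnRel, zero_mul]
  have hlift (p : MvPolynomial (Fin 2) k) :
      Ideal.Quotient.liftₐ _ (tnPsi k) hker (Ideal.Quotient.mk _ p) = tnPsi k p :=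
    Ideal.Quotient.lift_mk _ _ _
  have hnormal (p : MvPolynomial (Fin 2) k) (a b : Polynomial k)
      (h : tnRel k ∣ p - (Polynomial.aeval (X 0) a + X 1 * Polynomial.aeval (X 0) b)) :
      tnPsi k p = (a + Polynomial.X ^ 2 * b, a) := by
    rw [← tnPsi_add_mul, ← sub_eq_zero, ← map_sub]
    exact hker _ (Ideal.mem_span_singleton.mpr h)
  refine ⟨Ideal.Quotient.liftₐ _ (tnPsi k) hker, hlift, ?_, ?_⟩
  · rw [injective_iff_map_eq_zero]
    intro q hq
    obtain ⟨p, rfl⟩ := Ideal.Quotient.mk_surjective q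
    obtain ⟨a, b, h⟩ := exists_tnRel_dvd_sub k p
    rw [hlift, hnormal p a b h, Prod.mk_eq_zero] at hq
    obtain ⟨hb, rfl⟩ := hq
    obtain rfl : b = 0 := by simpa using hb
    rw [Ideal.Quotient.eq_zero_iff_mem, Ideal.mem_span_singleton]
    simpa using h
  · ext ⟨f, g⟩
    rw [Set.mem_ofPred_eq, ← X_sq_dvd_sub_iff]
    constructor
    · rintro ⟨q, hq⟩
      obtain ⟨p, rfl⟩ := Ideal.Quotient.mk_surjective q
      obtain ⟨a, b, h⟩ := exists_tnRel_dvd_sub k p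
      rw [hlift, hnormal p a b h, Prod.mk.injEq] at hq
      exact ⟨b, by rw [← hq.1, ← hq.2]; ring⟩
    · rintro ⟨b, hb⟩
      refine ⟨Ideal.Quotient.mk _
        (Polynomial.aeval (X 0) g + X 1 * Polynomial.aeval (X 0) b), ?_⟩
      rw [hlift, tnPsi_add_mul, Prod.mk.injEq]
      exact ⟨by linear_combination -hb, rfl⟩
end
end

section
/- Let k be a field of characteristic 2 and let A = k[X, Y]/(Y² − X³), with x and y denoting the images of X and Y. Then: (a) there is a (unique) k-linear derivation D₀ : A → A with D₀(x) = 0 and D₀(y) = 1 (induced by ∂/∂Y, which is well defined on A since ∂(Y² − X³)/∂Y = 2Y = 0 in characteristic 2); (b) every k-linear derivation D : A → A satisfies D(x) = 0 and D = D(y)·D₀; consequently the A-module of k-linear derivations of A is free of rank one, generated by D₀. -/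
set_option synthInstance.maxHeartbeats 400000
set_option maxHeartbeats 1000000

noncomputable section

open MvPolynomial

/-- The affine coordinate ring `A = k[X,Y]/(Y² − X³)` of the cuspidal cubic. -/
abbrev CuspAlg (k : Type*) [Field k] :=
  MvPolynomial (Fin 2) k ⧸
    Ideal.span {(X 1 ^ 2 - X 0 ^ 3 : MvPolynomial (Fin 2) k)}

/-- The image `x` of `X` in `A`. -/
def cuspX (k : Type*) [Field k] : CuspAlg k :=
  Ideal.Quotient.mk (Ideal.span {(X 1 ^ 2 - X 0 ^ 3 : MvPolynomial (Fin 2) k)}) (X 0)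

/-- The image `y` of `Y` in `A`. -/
def cuspY (k : Type*) [Field k] : CuspAlg k :=
  Ideal.Quotient.mk (Ideal.span {(X 1 ^ 2 - X 0 ^ 3 : MvPolynomial (Fin 2) k)}) (X 1)

/-- The coordinates of the cuspidal cubic satisfy its equation. -/
theorem cuspY_sq (k : Type*) [Field k] : cuspY k ^ 2 = cuspX k ^ 3 := by
  rw [cuspX, cuspY, ← map_pow, ← map_pow]
  exact Ideal.Quotient.eq.2 (Ideal.subset_span rfl)

/-- The coordinate `x` is not a zero divisor on the cuspidal cubic. -/
theorem eq_zero_of_cuspX_mul_eq_zero {k : Type*} [Field k] {a : CuspAlg k}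
    (h : cuspX k * a = 0) : a = 0 := by
  obtain ⟨f, rfl⟩ := Ideal.Quotient.mk_surjective a
  rw [cuspX, ← map_mul, Ideal.Quotient.eq_zero_iff_mem, Ideal.mem_span_singleton] at h
  obtain ⟨g, hg⟩ := h
  have hX : Prime (X 0 : MvPolynomial (Fin 2) k) := X_prime
  have hdvd : (X 0 : MvPolynomial (Fin 2) k) ∣ g := by
    refine (hX.dvd_or_dvd ⟨f, hg.symm⟩).resolve_left ?_
    rintro ⟨q, hq⟩
    have := congrArg (eval ![(0 : k), 1]) hq
    simp at this
  obtain ⟨q, rfl⟩ := hdvd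
  rw [Ideal.Quotient.eq_zero_iff_mem, Ideal.mem_span_singleton]
  exact ⟨q, mul_left_cancel₀ hX.ne_zero (by rw [hg]; ring)⟩

/-- Derivations of the cuspidal cubic are determined by their values on the coordinates. -/
theorem cuspAlg_derivation_ext {k : Type*} [Field k]
    {D D' : Derivation k (CuspAlg k) (CuspAlg k)}
    (hx : D (cuspX k) = D' (cuspX k)) (hy : D (cuspY k) = D' (cuspY k)) : D = D' := by
  have h : D.compAlgebraMap (MvPolynomial (Fin 2) k) =
      D'.compAlgebraMap (MvPolynomial (Fin 2) k) := by
    refine derivation_ext fun i => ?_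
    fin_cases i
    · exact hx
    · exact hy
  ext a
  obtain ⟨f, rfl⟩ := Ideal.Quotient.mk_surjective a
  exact DFunLike.congr_fun h f

/-- In characteristic `2`, `∂/∂Y` preserves the ideal of the cuspidal cubic. -/
theorem mk_pderiv_eq_zero {k : Type*} [Field k] [CharP k 2] (f : MvPolynomial (Fin 2) k)
    (hf : Ideal.Quotient.mkₐ k
      (Ideal.span {(X 1 ^ 2 - X 0 ^ 3 : MvPolynomial (Fin 2) k)}) f = 0) :
    Ideal.Quotient.mkₐ k (Ideal.span {(X 1 ^ 2 - X 0 ^ 3 : MvPolynomial (Fin 2) k)})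
      (pderiv 1 f) = 0 := by
  rw [Ideal.Quotient.mkₐ_eq_mk, Ideal.Quotient.eq_zero_iff_mem,
    Ideal.mem_span_singleton] at hf ⊢
  obtain ⟨g, rfl⟩ := hf
  have hp : pderiv 1 (X 1 ^ 2 - X 0 ^ 3 : MvPolynomial (Fin 2) k) = 0 := by
    simp [Derivation.leibniz_pow, pderiv_X, two_smul,
      CharTwo.add_self_eq_zero]
  rw [Derivation.leibniz, hp, smul_zero, add_zero, smul_eq_mul]
  exact dvd_mul_right _ _

/-- In characteristic `2`, every derivation of the cuspidal cubic kills `x`. -/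
theorem derivation_cuspX {k : Type*} [Field k] [CharP k 2]
    (D : Derivation k (CuspAlg k) (CuspAlg k)) : D (cuspX k) = 0 := by
  have h2 : (2 : CuspAlg k) = 0 := by
    have h := congrArg (algebraMap k (CuspAlg k)) (CharTwo.two_eq_zero (R := k))
    rwa [map_ofNat, map_zero] at h
  have h := congrArg D (cuspY_sq k)
  simp only [Derivation.leibniz_pow, nsmul_eq_mul, smul_eq_mul, Nat.cast_ofNat] at h
  refine eq_zero_of_cuspX_mul_eq_zero (eq_zero_of_cuspX_mul_eq_zero ?_)
  norm_num at h
  linear_combination (cuspY k * D (cuspY k) - cuspX k ^ 2 * D (cuspX k)) * h2 - h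

/-- over a field of characteristic `2`, the cuspidal cubic
`A = k[X,Y]/(Y² − X³)` has a unique `k`-derivation `D₀` with `D₀(x) = 0`, `D₀(y) = 1`
(induced by `∂/∂Y`), and every `k`-derivation `D : A → A` satisfies `D(x) = 0` and
`D = D(y) • D₀`; so the `A`-module of `k`-derivations of `A` is free of rank one on `D₀`. -/
theorem stmt11 (k : Type*) [Field k] [CharP k 2] :
    ∃ D0 : Derivation k (CuspAlg k) (CuspAlg k),
      (D0 (cuspX k) = 0 ∧ D0 (cuspY k) = 1) ∧
      (∀ D0' : Derivation k (CuspAlg k) (CuspAlg k),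
        D0' (cuspX k) = 0 ∧ D0' (cuspY k) = 1 → D0' = D0) ∧
      (∀ D : Derivation k (CuspAlg k) (CuspAlg k),
        D (cuspX k) = 0 ∧ D = D (cuspY k) • D0) := by
  let D0 : Derivation k (CuspAlg k) (CuspAlg k) :=
    Derivation.liftOfSurjective (Ideal.Quotient.mkₐ_surjective k _) mk_pderiv_eq_zero
  have h0 (f : MvPolynomial (Fin 2) k) :
      D0 (Ideal.Quotient.mk _ f) = Ideal.Quotient.mk _ (pderiv 1 f) :=
    Derivation.liftOfSurjective_apply (Ideal.Quotient.mkₐ_surjective k _) mk_pderiv_eq_zero f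
  have hx : D0 (cuspX k) = 0 := derivation_cuspX D0
  have hy : D0 (cuspY k) = 1 := by
    rw [cuspY, h0, pderiv_X_self, map_one]
  refine ⟨D0, ⟨hx, hy⟩, fun D h => ?_, fun D => ⟨derivation_cuspX D, ?_⟩⟩
  · exact cuspAlg_derivation_ext (h.1.trans hx.symm) (h.2.trans hy.symm)
  · apply cuspAlg_derivation_ext
    · rw [Derivation.smul_apply, hx, smul_zero, derivation_cuspX]
    · rw [Derivation.smul_apply, hy, smul_eq_mul, mul_one]
end
end

section
/- Let k be a field. Consider tuples z = (z₁₂, z₁₃, z₁₄, z₁₅, z₂₃, z₂₄, z₂₅, z₃₄, z₃₅, z₄₅) ∈ k^{10} satisfying the five Plücker relations z₁₂·z₃₄ + z₁₄·z₂₃ = z₁₃·z₂₄, z₁₃·z₄₅ + z₁₅·z₃₄ = z₁₄·z₃₅, z₁₂·z₄₅ + z₁₅·z₂₄ = z₁₄·z₂₅, z₁₂·z₃₅ + z₁₅·z₂₃ = z₁₃·z₂₅, z₂₃·z₄₅ + z₂₅·z₃₄ = z₂₄·z₃₅, together with the six linear equations z₁₂ = z₂₄, z₁₃ = z₃₅,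 z₁₄ + z₂₄ = 0, z₁₅ + z₃₅ = 0, z₂₅ = 0, z₃₄ = 0. Then a nonzero tuple z satisfies all these equations if and only if z is a nonzero scalar multiple of exactly one of the following five vectors (coordinates listed in the order z₁₂, z₁₃, z₁₄, z₁₅, z₂₃, z₂₄, z₂₅, z₃₄, z₃₅, z₄₅): p₁ = (1, 0, −1, 0, 0, 1, 0, 0, 0, 0), p₂ = (0, 1, 0, −1, 0, 0, 0, 0, 1, 0), p₃ = (0, 0, 0, 0, 1, 0, 0, 0, 0, 0), p₄ = (0, 0, 0, 0, 0, 0, 0, 0, 0, 1), p₅ = (1, −1, −1, 1, 1, 1, 0, 0, −1, −1). -/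
/-- The five intersection points of `L = ℙ³` with `Gr(2,5) ⊂ ℙ⁹`, with Plücker coordinates
listed in the order `z₁₂, z₁₃, z₁₄, z₁₅, z₂₃, z₂₄, z₂₅, z₃₄, z₃₅, z₄₅`. -/
def pluckerPts (k : Type*) [Field k] : Fin 5 → Fin 10 → k :=
  ![![1, 0, -1, 0, 0, 1, 0, 0, 0, 0],
    ![0, 1, 0, -1, 0, 0, 0, 0, 1, 0],
    ![0, 0, 0, 0, 1, 0, 0, 0, 0, 0],
    ![0, 0, 0, 0, 0, 0, 0, 0, 0, 1],
    ![1, -1, -1, 1, 1, 1, 0, 0, -1, -1]]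

/-- Nonzero multiples of distinct points among `p₁, …, p₅` are distinct. -/
theorem pluckerPts_index_unique {k : Type*} [Field k] {m n : Fin 5} {c d : k} (hc : c ≠ 0)
    (hd : d ≠ 0) (h : c • pluckerPts k m = d • pluckerPts k n) : m = n := by
  have h0 := congrFun h 0
  have h1 := congrFun h 1
  have h4 := congrFun h 4
  have h9 := congrFun h 9
  fin_cases m <;> fin_cases n <;> simp_all [pluckerPts]

/-- On `L`, the coordinates `z₁₂`, `z₁₃`, `z₂₃`, `z₄₅` decide whether `z` is a given multiple of a
point. -/
theorem eq_smul_pluckerPts_iff {k : Type*} [Field k] {z : Fin 10 → k} (h05 : z 0 = z 5)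
    (h18 : z 1 = z 8) (h25 : z 2 + z 5 = 0) (h38 : z 3 + z 8 = 0) (h6 : z 6 = 0) (h7 : z 7 = 0)
    (m : Fin 5) (c : k) :
    z = c • pluckerPts k m ↔ z 0 = c * pluckerPts k m 0 ∧ z 1 = c * pluckerPts k m 1 ∧
      z 4 = c * pluckerPts k m 4 ∧ z 9 = c * pluckerPts k m 9 := by
  refine ⟨fun h ↦ ⟨congrFun h 0, congrFun h 1, congrFun h 4, congrFun h 9⟩, ?_⟩
  rintro ⟨h0, h1, h4, h9⟩
  ext i
  fin_cases m <;> fin_cases i <;> simp [pluckerPts] at h0 h1 h4 h9 ⊢ <;> grind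

/-- key computation of Proposition 1.22: a nonzero vector
`z = (z₁₂, …, z₄₅) ∈ k¹⁰` satisfies the five Plücker relations and the six linear equations
cutting out `L` if and only if it is a nonzero scalar multiple of exactly one of the five
points `p₁, …, p₅`. Coordinates: `z 0 = z₁₂`, `z 1 = z₁₃`, `z 2 = z₁₄`, `z 3 = z₁₅`,
`z 4 = z₂₃`, `z 5 = z₂₄`, `z 6 = z₂₅`, `z 7 = z₃₄`, `z 8 = z₃₅`, `z 9 = z₄₅`. -/
theorem stmt14 (k : Type*) [Field k] (z : Fin 10 → k) (hz : z ≠ 0) :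
    (z 0 * z 7 + z 2 * z 4 = z 1 * z 5 ∧
     z 1 * z 9 + z 3 * z 7 = z 2 * z 8 ∧
     z 0 * z 9 + z 3 * z 5 = z 2 * z 6 ∧
     z 0 * z 8 + z 3 * z 4 = z 1 * z 6 ∧
     z 4 * z 9 + z 6 * z 7 = z 5 * z 8 ∧
     z 0 = z 5 ∧ z 1 = z 8 ∧ z 2 + z 5 = 0 ∧ z 3 + z 8 = 0 ∧ z 6 = 0 ∧ z 7 = 0) ↔
    (∃! m : Fin 5, ∃ c : k, c ≠ 0 ∧ z = c • pluckerPts k m) := by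
  constructor
  · rintro ⟨e1, e2, e3, e4, e5, h05, h18, h25, h38, h6, h7⟩
    suffices h : ∃ m : Fin 5, ∃ c : k, c ≠ 0 ∧ z = c • pluckerPts k m by
      obtain ⟨m, c, hc, h⟩ := h
      exact ⟨m, ⟨c, hc, h⟩, fun n ⟨d, hd, h'⟩ ↦ pluckerPts_index_unique hd hc (h' ▸ h)⟩
    have key := eq_smul_pluckerPts_iff h05 h18 h25 h38 h6 h7
    by_cases ha : z 0 = 0
    · by_cases hb : z 1 = 0
      · by_cases hc : z 4 = 0
        · refine ⟨3, z 9, fun hd ↦ hz ?_, (key 3 _).2 ?_⟩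
          · ext i
            fin_cases i <;> simp <;> grind
          · simp [pluckerPts, ha, hb, hc]
        · refine ⟨2, z 4, hc, (key 2 _).2 ?_⟩
          simp [pluckerPts]
          grind
      · refine ⟨1, z 1, hb, (key 1 _).2 ?_⟩
        simp [pluckerPts]
        grind
    · by_cases hb : z 1 = 0
      · refine ⟨0, z 0, ha, (key 0 _).2 ?_⟩
        simp [pluckerPts]
        grind
      · refine ⟨4, z 0, ha, (key 4 _).2 ?_⟩
        simp [pluckerPts]
        grind
  · rintro ⟨m, ⟨c, -, rfl⟩, -⟩
    fin_cases m <;> simp [pluckerPts]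
end

section
/- Let k be a field and n ≥ 6. A nonzero vector y = (y₂, y₃, …, y_{n−1}) ∈ k^{n−2} satisfies y_i·y_j = y₂·y₃ for all 2 ≤ i < j ≤ n−1 if and only if y is a nonzero scalar multiple of either the all-ones vector (1, 1, …, 1) or one of the standard basis vectors e_i (the vector with 1 in position i and 0 in all other positions) for 2 ≤ i ≤ n−1. In particular, the projective variety in P^{n−3} defined by the equations y_i·y_j = y₂·y₃ consists of exactly n−1 points. -/
/-- If all products of two entries at distinct indices agree, and the index type has a third
element for any two, then a nonzero vector is constant or supported at a single index. -/
theorem const_or_single_of_mul_eq {ι k : Type*} [DecidableEq ι] [Field k] {y : ι → k} {p : k}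
    (hι : ∀ a b : ι, ∃ c, c ≠ a ∧ c ≠ b) (hy : y ≠ 0) (h : ∀ i j, i ≠ j → y i * y j = p) :
    (∃ c : k, c ≠ 0 ∧ y = fun _ => c) ∨
      (∃ i₀ : ι, ∃ c : k, c ≠ 0 ∧ y = fun i => if i = i₀ then c else 0) := by
  obtain ⟨a, ha⟩ := Function.ne_iff.mp hy
  rw [Pi.zero_apply] at ha
  by_cases hp : p = 0
  · refine Or.inr ⟨a, y a, ha, funext fun i => ?_⟩
    split_ifs with hi
    · rw [hi]
    · exact (mul_eq_zero.mp ((h i a hi).trans hp)).resolve_right ha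
  · refine Or.inl ⟨y a, ha, funext fun i => ?_⟩
    obtain ⟨c, hci, hca⟩ := hι i a
    have hc : y c ≠ 0 := fun h0 => hp (by rw [← h c a hca, h0, zero_mul])
    exact mul_left_cancel₀ hc ((h c i hci).trans (h c a hca).symm)


/-- computation of Proposition 1.20(i): for `n ≥ 6` and a field `k`,
a nonzero vector `y = (y₂, …, y_{n−1})` satisfies `y_i y_j = y₂ y₃` for all
`2 ≤ i < j ≤ n−1` if and only if it is a nonzero scalar multiple of either the all-ones
vector or one of the standard basis vectors; in particular the projective subvariety of
`ℙ^{n−3}` cut out by these equations consists of exactly `n − 1` points. -/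
theorem stmt15 (n : ℕ) (hn : 6 ≤ n) (k : Type*) [Field k]
    (y : {i : ℕ // 2 ≤ i ∧ i ≤ n - 1} → k) (hy : y ≠ 0) :
    (∀ i j : {i : ℕ // 2 ≤ i ∧ i ≤ n - 1}, i.1 < j.1 →
      y i * y j = y ⟨2, by omega⟩ * y ⟨3, by omega⟩) ↔
    ((∃ c : k, c ≠ 0 ∧ y = fun _ => c) ∨
      (∃ i0 : {i : ℕ // 2 ≤ i ∧ i ≤ n - 1}, ∃ c : k, c ≠ 0 ∧
        y = fun i => if i = i0 then c else 0)) := by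
  constructor
  · intro h
    refine const_or_single_of_mul_eq (p := y ⟨2, by omega⟩ * y ⟨3, by omega⟩) ?_ hy ?_
    · rintro ⟨a, ha⟩ ⟨b, hb⟩
      have : ∃ c, (2 ≤ c ∧ c ≤ 4) ∧ c ≠ a ∧ c ≠ b := by
        by_cases h2 : 2 ≠ a ∧ 2 ≠ b
        · exact ⟨2, by omega, h2⟩
        by_cases h3 : 3 ≠ a ∧ 3 ≠ b
        · exact ⟨3, by omega, h3⟩
        exact ⟨4, by omega, by omega⟩
      obtain ⟨c, hc, hca, hcb⟩ := this
      exact ⟨⟨c, by omega⟩, by simpa using hca, by simpa using hcb⟩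
    · intro i j hij
      rcases lt_or_gt_of_ne (Subtype.coe_ne_coe.mpr hij) with hlt | hlt
      · exact h i j hlt
      · rw [mul_comm, h j i hlt]
  · have single_mul : ∀ (i₀ i j : {i : ℕ // 2 ≤ i ∧ i ≤ n - 1}) (c : k), i.1 < j.1 →
        (if i = i₀ then c else 0) * (if j = i₀ then c else 0) = 0 := by
      intro i₀ i j c hij
      split_ifs with h₁ h₂
      · subst h₁ h₂
        exact absurd hij (lt_irrefl _)
      all_goals simp
    rintro (⟨c, -, rfl⟩ | ⟨i₀, c, -, rfl⟩) i j hij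
    · rfl
    · exact (single_mul i₀ i j c hij).trans (single_mul i₀ _ _ c (by simp)).symm
end

section
/- Let n ≥ 5 and let R be a commutative ring. Then each of the following two substitutions on the generators of B_n(R) preserves the defining relations and hence induces a well-defined R-algebra automorphism of B_n(R) of order two: (I) a ↦ a, c ↦ c̄, c̄ ↦ c, c_i ↦ c̄_i, c̄_i ↦ c_i for 4 ≤ i ≤ n, and c_{ij} ↦ a + c_i + c̄_i + c_j + c̄_j − c_{ij} for 4 ≤ i < j ≤ n; (II) a ↦ −a, c ↦ c − c̄, c̄ ↦ −c̄, c_i ↦ a + c_i + c̄_i, c̄_i ↦ −c̄_i for 4 ≤ i ≤ n, and c_{ij} ↦ c_{ij} − c̄_i for 4 ≤ i < j ≤ n. -/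
noncomputable section

open MvPolynomial

section Relations

variable {n : ℕ} {R : Type*} [CommRing R]

theorem bmk_eq_zero_of_mem {p : MvPolynomial (BVar n) R} (hp : p ∈ bRels n R) :
    bmk n R p = 0 :=
  Ideal.Quotient.eq_zero_iff_mem.mpr (Ideal.subset_span hp)

theorem bmk_rel_lo {i j : ℕ} (hi : 4 ≤ i) (hij : i < j) (hj : j ≤ n) :
    bmk n R ((pLo n R j - pLo n R i) * pMix n R i j -
      ((pA n R + pHi n R i + pLo n R j + pHi n R j) * pLo n R j - pC n R)) = 0 :=
  bmk_eq_zero_of_mem (.inl (.inl ⟨i, j, hi, hij, hj, rfl⟩))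

theorem bmk_rel_hi {i j : ℕ} (hi : 4 ≤ i) (hij : i < j) (hj : j ≤ n) :
    bmk n R ((pHi n R i - pHi n R j) * pMix n R i j -
      ((pA n R + pLo n R i + pHi n R i + pLo n R j) * pHi n R i - pCb n R)) = 0 :=
  bmk_eq_zero_of_mem (.inl (.inr ⟨i, j, hi, hij, hj, rfl⟩))

theorem bmk_rel_mix {i j k : ℕ} (hi : 4 ≤ i) (hij : i < j) (hjk : j < k) (hk : k ≤ n) :
    bmk n R (pMix n R i j * pMix n R j k + pMixRev n R i j * pMix n R i k -
      pMix n R i k * pMix n R j k +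
      (pA n R + pLo n R k + pHi n R k) * pLo n R k - pC n R) = 0 :=
  bmk_eq_zero_of_mem (.inr ⟨i, j, k, hi, hij, hjk, hk, rfl⟩)

/-- An involutive substitution preserving the relations descends to an involution of `B_n(R)`. -/
theorem exists_involution_of_substitution
    (φ : MvPolynomial (BVar n) R →ₐ[R] MvPolynomial (BVar n) R)
    (hrel : ∀ p ∈ bRels n R, bmk n R (φ p) = 0) (hinv : ∀ v, φ (φ (X v)) = X v) :
    ∃ σ : BRing n R ≃ₐ[R] BRing n R,
      (∀ x, σ (σ x) = x) ∧ ∀ p, σ (bmk n R p) = bmk n R (φ p) := by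
  have hle : bIdeal n R ≤ (bIdeal n R).comap φ :=
    Ideal.span_le.mpr fun p hp =>
      Ideal.mem_comap.mpr (Ideal.Quotient.eq_zero_iff_mem.mp (hrel p hp))
  let τ : BRing n R →ₐ[R] BRing n R := Ideal.quotientMapₐ (bIdeal n R) φ hle
  have hτ (p) : τ (bmk n R p) = bmk n R (φ p) := rfl
  have hφ : φ.comp φ = AlgHom.id R _ := MvPolynomial.algHom_ext hinv
  have hττ (x) : τ (τ x) = x := by
    obtain ⟨p, rfl⟩ : ∃ p, bmk n R p = x := Ideal.Quotient.mk_surjective x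
    rw [hτ, hτ]
    exact congrArg (bmk n R) (DFunLike.congr_fun hφ p)
  exact ⟨AlgEquiv.ofAlgHom τ τ (AlgHom.ext hττ) (AlgHom.ext hττ), hττ, hτ⟩

end Relations

section Substitutions

variable (n : ℕ) (R : Type*) [CommRing R]

/-- The substitution given by the transposition `(13)`. -/
def subst13 : MvPolynomial (BVar n) R →ₐ[R] MvPolynomial (BVar n) R :=
  aeval fun
    | .A => pA n R
    | .Cc => pCb n R
    | .Cb => pC n R
    | .lo i => pHi n R i
    | .hi i => pLo n R i
    | .mix p => pMixRev n R p.1.1 p.1.2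

/-- The substitution given by the transposition `(23)`. -/
def subst23 : MvPolynomial (BVar n) R →ₐ[R] MvPolynomial (BVar n) R :=
  aeval fun
    | .A => -pA n R
    | .Cc => pC n R - pCb n R
    | .Cb => -pCb n R
    | .lo i => pA n R + pLo n R i + pHi n R i
    | .hi i => -pHi n R i
    | .mix p => pMix n R p.1.1 p.1.2 - pHi n R p.1.1

@[simp]
theorem subst13_pA : subst13 n R (pA n R) = pA n R := by
  simp [subst13, pA]

@[simp]
theorem subst13_pC : subst13 n R (pC n R) = pCb n R := by
  simp [subst13, pC]

@[simp]
theorem subst13_pCb : subst13 n R (pCb n R) = pC n R := by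
  simp [subst13, pCb]

@[simp]
theorem subst13_pLo (i : ℕ) (hi : 4 ≤ i) (hi' : i ≤ n) : subst13 n R (pLo n R i) = pHi n R i := by
  have hX : pLo n R i = X (.lo ⟨i, hi, hi'⟩) := dif_pos ⟨hi, hi'⟩
  exact (congrArg _ hX).trans (aeval_X _ _)

@[simp]
theorem subst13_pHi (i : ℕ) (hi : 4 ≤ i) (hi' : i ≤ n) : subst13 n R (pHi n R i) = pLo n R i := by
  have hX : pHi n R i = X (.hi ⟨i, hi, hi'⟩) := dif_pos ⟨hi, hi'⟩
  exact (congrArg _ hX).trans (aeval_X _ _)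

@[simp]
theorem subst13_pMix (i j : ℕ) (hi : 4 ≤ i) (hij : i < j) (hj : j ≤ n) :
    subst13 n R (pMix n R i j) = pMixRev n R i j := by
  have hX : pMix n R i j = X (.mix ⟨(i, j), hi, hij, hj⟩) := dif_pos ⟨hi, hij, hj⟩
  exact (congrArg _ hX).trans (aeval_X _ _)

@[simp]
theorem subst23_pA : subst23 n R (pA n R) = -pA n R := by
  simp [subst23, pA]

@[simp]
theorem subst23_pC : subst23 n R (pC n R) = pC n R - pCb n R := by
  simp [subst23, pC]

@[simp]
theorem subst23_pCb : subst23 n R (pCb n R) = -pCb n R := by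
  simp [subst23, pCb]

@[simp]
theorem subst23_pLo (i : ℕ) (hi : 4 ≤ i) (hi' : i ≤ n) :
    subst23 n R (pLo n R i) = pA n R + pLo n R i + pHi n R i := by
  have hX : pLo n R i = X (.lo ⟨i, hi, hi'⟩) := dif_pos ⟨hi, hi'⟩
  exact (congrArg _ hX).trans (aeval_X _ _)

@[simp]
theorem subst23_pHi (i : ℕ) (hi : 4 ≤ i) (hi' : i ≤ n) : subst23 n R (pHi n R i) = -pHi n R i := by
  have hX : pHi n R i = X (.hi ⟨i, hi, hi'⟩) := dif_pos ⟨hi, hi'⟩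
  exact (congrArg _ hX).trans (aeval_X _ _)

@[simp]
theorem subst23_pMix (i j : ℕ) (hi : 4 ≤ i) (hij : i < j) (hj : j ≤ n) :
    subst23 n R (pMix n R i j) = pMix n R i j - pHi n R i := by
  have hX : pMix n R i j = X (.mix ⟨(i, j), hi, hij, hj⟩) := dif_pos ⟨hi, hij, hj⟩
  exact (congrArg _ hX).trans (aeval_X _ _)

theorem subst13_subst13_X (v : BVar n) : subst13 n R (subst13 n R (X v)) = X v := by
  match v with
  | .A => change subst13 n R (subst13 n R (pA n R)) = pA n R; simp
  | .Cc => change subst13 n R (subst13 n R (pC n R)) = pC n R; simp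
  | .Cb => change subst13 n R (subst13 n R (pCb n R)) = pCb n R; simp
  | .lo ⟨i, hi, hi'⟩ =>
    have hX : X (.lo ⟨i, hi, hi'⟩) = pLo n R i := by simp [pLo, hi, hi']
    simp [hX, hi, hi']
  | .hi ⟨i, hi, hi'⟩ =>
    have hX : X (.hi ⟨i, hi, hi'⟩) = pHi n R i := by simp [pHi, hi, hi']
    simp [hX, hi, hi']
  | .mix ⟨(i, j), hi, hij, hj⟩ =>
    have hX : X (.mix ⟨(i, j), hi, hij, hj⟩) = pMix n R i j := by
      simp [pMix, hi, hij, hj]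
    have hi' : i ≤ n := by grind
    have hj' : 4 ≤ j := by grind
    rw [hX]
    simp [pMixRev, hi, hi', hij, hj, hj']
    ring

theorem bmk_subst13_eq_zero {p : MvPolynomial (BVar n) R} (hp : p ∈ bRels n R) :
    bmk n R (subst13 n R p) = 0 := by
  rcases hp with (⟨i, j, hi, hij, hj, rfl⟩ | ⟨i, j, hi, hij, hj, rfl⟩) |
    ⟨i, j, k, hi, hij, hjk, hk, rfl⟩
  · have hhi := bmk_rel_hi (R := R) hi hij hj
    have hi' : i ≤ n := by grind
    have hj' : 4 ≤ j := by grind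
    simp only [pMixRev, map_add, map_sub, map_mul, subst13_pA, subst13_pC,
      subst13_pLo, subst13_pHi, subst13_pMix, hi, hi', hij, hj, hj'] at hhi ⊢
    linear_combination hhi
  · have hlo := bmk_rel_lo (R := R) hi hij hj
    have hi' : i ≤ n := by grind
    have hj' : 4 ≤ j := by grind
    simp only [pMixRev, map_add, map_sub, map_mul, subst13_pA, subst13_pCb,
      subst13_pLo, subst13_pHi, subst13_pMix, hi, hi', hij, hj, hj'] at hlo ⊢
    linear_combination hlo
  · have hi' : i ≤ n := by grind
    have hj : 4 ≤ j := by grind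
    have hj' : j ≤ n := by grind
    have hk' : 4 ≤ k := by grind
    have hik : i < k := by grind
    have hmix := bmk_rel_mix (R := R) hi hij hjk hk
    have hloij := bmk_rel_lo (R := R) hi hij hj'
    have hhiij := bmk_rel_hi (R := R) hi hij hj'
    have hlojk := bmk_rel_lo (R := R) hj hjk hk
    have hhijk := bmk_rel_hi (R := R) hj hjk hk
    have hloik := bmk_rel_lo (R := R) hi hik hk
    have hhiik := bmk_rel_hi (R := R) hi hik hk
    simp only [pMixRev, map_add, map_sub, map_mul, subst13_pA, subst13_pC,
      subst13_pLo, subst13_pHi, subst13_pMix, hi, hi', hij, hj, hj', hjk, hk, hk', hik]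
      at hmix hloij hhiij hlojk hhijk hloik hhiik ⊢
    linear_combination hmix - hloij + hhiij + hlojk - hhijk + hloik - hhiik

theorem subst23_subst23_X (v : BVar n) : subst23 n R (subst23 n R (X v)) = X v := by
  match v with
  | .A => change subst23 n R (subst23 n R (pA n R)) = pA n R; simp
  | .Cc => change subst23 n R (subst23 n R (pC n R)) = pC n R; simp
  | .Cb => change subst23 n R (subst23 n R (pCb n R)) = pCb n R; simp
  | .lo ⟨i, hi, hi'⟩ =>
    have hX : X (.lo ⟨i, hi, hi'⟩) = pLo n R i := by simp [pLo, hi, hi']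
    simp [hX, hi, hi']
    ring
  | .hi ⟨i, hi, hi'⟩ =>
    have hX : X (.hi ⟨i, hi, hi'⟩) = pHi n R i := by simp [pHi, hi, hi']
    simp [hX, hi, hi']
  | .mix ⟨(i, j), hi, hij, hj⟩ =>
    have hX : X (.mix ⟨(i, j), hi, hij, hj⟩) = pMix n R i j := by
      simp [pMix, hi, hij, hj]
    have hi' : i ≤ n := by grind
    rw [hX]
    simp [hi, hi', hij, hj]

theorem bmk_subst23_eq_zero {p : MvPolynomial (BVar n) R} (hp : p ∈ bRels n R) :
    bmk n R (subst23 n R p) = 0 := by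
  rcases hp with (⟨i, j, hi, hij, hj, rfl⟩ | ⟨i, j, hi, hij, hj, rfl⟩) |
    ⟨i, j, k, hi, hij, hjk, hk, rfl⟩
  · have hlo := bmk_rel_lo (R := R) hi hij hj
    have hhi := bmk_rel_hi (R := R) hi hij hj
    have hi' : i ≤ n := by grind
    have hj' : 4 ≤ j := by grind
    simp only [map_add, map_sub, map_mul, map_neg, subst23_pA, subst23_pC,
      subst23_pLo, subst23_pHi, subst23_pMix, hi, hi', hij, hj, hj'] at hlo hhi ⊢
    linear_combination hlo - hhi
  · have hhi := bmk_rel_hi (R := R) hi hij hj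
    have hi' : i ≤ n := by grind
    have hj' : 4 ≤ j := by grind
    simp only [map_add, map_sub, map_mul, map_neg, subst23_pA, subst23_pCb,
      subst23_pLo, subst23_pHi, subst23_pMix, hi, hi', hij, hj, hj'] at hhi ⊢
    linear_combination -hhi
  · have hi' : i ≤ n := by grind
    have hj : 4 ≤ j := by grind
    have hj' : j ≤ n := by grind
    have hk' : 4 ≤ k := by grind
    have hik : i < k := by grind
    have hmix := bmk_rel_mix (R := R) hi hij hjk hk
    have hhiij := bmk_rel_hi (R := R) hi hij hj'
    simp only [pMixRev, map_add, map_sub, map_mul, map_neg, subst23_pA, subst23_pC,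
      subst23_pLo, subst23_pHi, subst23_pMix, hi, hi', hij, hj, hj', hjk, hk, hk', hik]
      at hmix hhiij ⊢
    linear_combination hmix + hhiij

end Substitutions

/-- actions of the transpositions (13) and (23) on `U_n`: for `n ≥ 5` and
any commutative ring `R`, the substitutions (I) and (II) preserve the defining relations and
induce well-defined `R`-algebra automorphisms of `B_n(R)` of order two. -/
theorem stmt16 (n : ℕ) (hn : 5 ≤ n) (R : Type*) [CommRing R] :
    (∃ σ : BRing n R ≃ₐ[R] BRing n R,
      (∀ x : BRing n R, σ (σ x) = x) ∧
      σ (bmk n R (pA n R)) = bmk n R (pA n R) ∧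
      σ (bmk n R (pC n R)) = bmk n R (pCb n R) ∧
      σ (bmk n R (pCb n R)) = bmk n R (pC n R) ∧
      (∀ i : ℕ, 4 ≤ i → i ≤ n →
        σ (bmk n R (pLo n R i)) = bmk n R (pHi n R i) ∧
        σ (bmk n R (pHi n R i)) = bmk n R (pLo n R i)) ∧
      (∀ i j : ℕ, 4 ≤ i → i < j → j ≤ n →
        σ (bmk n R (pMix n R i j)) = bmk n R (pMixRev n R i j))) ∧
    (∃ σ : BRing n R ≃ₐ[R] BRing n R,
      (∀ x : BRing n R, σ (σ x) = x) ∧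
      σ (bmk n R (pA n R)) = -bmk n R (pA n R) ∧
      σ (bmk n R (pC n R)) = bmk n R (pC n R) - bmk n R (pCb n R) ∧
      σ (bmk n R (pCb n R)) = -bmk n R (pCb n R) ∧
      (∀ i : ℕ, 4 ≤ i → i ≤ n →
        σ (bmk n R (pLo n R i)) = bmk n R (pA n R + pLo n R i + pHi n R i) ∧
        σ (bmk n R (pHi n R i)) = -bmk n R (pHi n R i)) ∧
      (∀ i j : ℕ, 4 ≤ i → i < j → j ≤ n →
        σ (bmk n R (pMix n R i j)) = bmk n R (pMix n R i j - pHi n R i))) := by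
  constructor
  · obtain ⟨σ, hσ, h⟩ := exists_involution_of_substitution (subst13 n R)
      (fun _ => bmk_subst13_eq_zero n R) (subst13_subst13_X n R)
    refine ⟨σ, hσ, by simp [h], by simp [h], by simp [h], fun i hi hi' => ?_,
      fun i j hi hij hj => ?_⟩
    · simp [h, hi, hi']
    · simp [h, hi, hij, hj]
  · obtain ⟨σ, hσ, h⟩ := exists_involution_of_substitution (subst23 n R)
      (fun _ => bmk_subst23_eq_zero n R) (subst23_subst23_X n R)
    refine ⟨σ, hσ, by simp [h], by simp [h], by simp [h], fun i hi hi' => ?_,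
      fun i j hi hij hj => ?_⟩
    · simp [h, hi, hi']
    · simp [h, hi, hij, hj]
end
end

section
/- Let n ≥ 5 and let R be a commutative ring. Then for any two distinct indices i, j with 4 ≤ i, j ≤ n, the following identity holds in B_n(R): (a + c_i + c̄_i)·c_i·c̄_i − c̄·c_i − c·c̄_i = (a + c_j + c̄_j)·c_j·c̄_j − c̄·c_j − c·c̄_j. -/
noncomputable section

open MvPolynomial

/-- For `i < j` the two relations (R1) and (R2) already force the identity: eliminate `c_{ij}`. -/
theorem bmk_eq_of_lt (n : ℕ) (R : Type*) [CommRing R] (i j : ℕ) (hi4 : 4 ≤ i) (hij : i < j)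
    (hjn : j ≤ n) :
    bmk n R ((pA n R + pLo n R i + pHi n R i) * pLo n R i * pHi n R i -
      pCb n R * pLo n R i - pC n R * pHi n R i) =
    bmk n R ((pA n R + pLo n R j + pHi n R j) * pLo n R j * pHi n R j -
      pCb n R * pLo n R j - pC n R * pHi n R j) := by
  have h₁ : (pLo n R j - pLo n R i) * pMix n R i j -
      ((pA n R + pHi n R i + pLo n R j + pHi n R j) * pLo n R j - pC n R) ∈ bIdeal n R :=
    Ideal.subset_span (Or.inl (Or.inl ⟨i, j, hi4, hij, hjn, rfl⟩))
  have h₂ : (pHi n R i - pHi n R j) * pMix n R i j -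
      ((pA n R + pLo n R i + pHi n R i + pLo n R j) * pHi n R i - pCb n R) ∈ bIdeal n R :=
    Ideal.subset_span (Or.inl (Or.inr ⟨i, j, hi4, hij, hjn, rfl⟩))
  refine Ideal.Quotient.eq.mpr ?_
  convert sub_mem ((bIdeal n R).mul_mem_left (pLo n R j - pLo n R i) h₂)
    ((bIdeal n R).mul_mem_left (pHi n R i - pHi n R j) h₁) using 1
  ring

/-- identity from the proof of Proposition 1.5(i): for `n ≥ 5`, any
commutative ring `R` and distinct `i, j ∈ [4, n]`, one has
`(a + c_i + c̄_i) c_i c̄_i − c̄ c_i − c c̄_i = (a + c_j + c̄_j) c_j c̄_j − c̄ c_j − c c̄_j`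
in `B_n(R)`. -/
theorem stmt17 (n : ℕ) (hn : 5 ≤ n) (R : Type*) [CommRing R]
    (i j : ℕ) (hi4 : 4 ≤ i) (hin : i ≤ n) (hj4 : 4 ≤ j) (hjn : j ≤ n) (hij : i ≠ j) :
    bmk n R ((pA n R + pLo n R i + pHi n R i) * pLo n R i * pHi n R i -
      pCb n R * pLo n R i - pC n R * pHi n R i) =
    bmk n R ((pA n R + pLo n R j + pHi n R j) * pLo n R j * pHi n R j -
      pCb n R * pLo n R j - pC n R * pHi n R j) := by
  rcases hij.lt_or_gt with h | h
  · exact bmk_eq_of_lt n R i j hi4 h hjn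
  · exact (bmk_eq_of_lt n R j i hj4 h hin).symm
end
end
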